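/- The number of conjugacy classes of regular subgroups of the holomorph $\operatorname{Hol}(G)$ of the abelian group $G = C_2\times C_2\times C_{16}$ is $3\,124$; equivalently, the number of isomorphism classes of left braces with additive group isomorphic to $C_2\times C_2\times C_{16}$ is $3\,124$. -/

import Mathlib

/-- A left brace structure on a set `B`: an abelian group operation `+` (with
zero element `zero` and negation `neg`), a group operation `*` (with identity
`one` and inversion `inv`), linked by the relation
`x * (y + z) = x * y - x + x * z`, i.e. `x * (y + z) = (x * y + (-x)) + x * z`. -/
structure LeftBrace (B : Type*) where
  add : B → B → B
  zero : B
  neg : B → B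
  mul : B → B → B
  one : B
  inv : B → B
  add_assoc : ∀ a b c, add (add a b) c = add a (add b c)
  add_comm : ∀ a b, add a b = add b a
  zero_add : ∀ a, add zero a = a
  neg_add_cancel : ∀ a, add (neg a) a = zero
  mul_assoc : ∀ a b c, mul (mul a b) c = mul a (mul b c)
  one_mul : ∀ a, mul one a = a
  mul_one : ∀ a, mul a one = a
  inv_mul_cancel : ∀ a, mul (inv a) a = one
  brace : ∀ x y z, mul x (add y z) = add (add (mul x y) (neg x)) (mul x z)

/-- Two left braces are isomorphic if there is a bijection preserving both
operations. -/
def LeftBrace.Iso {B₁ B₂ : Type*} (L₁ : LeftBrace B₁) (L₂ : LeftBrace B₂) : Prop :=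
  ∃ e : B₁ ≃ B₂, (∀ x y, e (L₁.add x y) = L₂.add (e x) (e y)) ∧
    (∀ x y, e (L₁.mul x y) = L₂.mul (e x) (e y))

/-- The additive group of the left brace `L` is isomorphic to the
(additively written) abelian group `A`. -/
def LeftBrace.AddIso {B : Type*} (L : LeftBrace B) (A : Type*) [AddGroup A] : Prop :=
  ∃ e : B ≃ A, ∀ x y, e (L.add x y) = e x + e y

/-- The multiplicative group of the left brace `L` is isomorphic to the
(additively written) group `A`. -/
def LeftBrace.MulIso {B : Type*} (L : LeftBrace B) (A : Type*) [AddGroup A] : Prop :=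
  ∃ e : B ≃ A, ∀ x y, e (L.mul x y) = e x + e y

/-- The holomorph of an (additive) abelian group `G`: the semidirect product
`G ⋊ Aut(G)` with respect to the natural action of `Aut(G)` on `G`, realized
on the carrier `G × AddAut G` with multiplication
`(g, α) * (h, β) = (g + α h, α * β)`. -/
abbrev Hol (G : Type*) [AddCommGroup G] : Type _ := G × AddAut G

instance Hol.instGroup (G : Type*) [AddCommGroup G] : Group (Hol G) where
  mul p q := (p.1 + p.2 q.1, p.2 + q.2)
  one := (0, 0)
  inv p := (-((-p.2) p.1), -p.2)
  mul_assoc a b c := by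
    refine Prod.ext ?_ ?_
    · show a.1 + a.2 b.1 + (a.2 + b.2) c.1 = a.1 + a.2 (b.1 + b.2 c.1)
      simp [AddAut.add_apply, map_add, add_assoc]
    · exact add_assoc a.2 b.2 c.2
  one_mul a := by
    refine Prod.ext ?_ ?_
    · show (0 : _) + (0 : AddAut _) a.1 = a.1
      simp
    · exact zero_add a.2
  mul_one a := by
    refine Prod.ext ?_ ?_
    · show a.1 + a.2 0 = a.1
      simp
    · exact add_zero a.2
  inv_mul_cancel a := by
    refine Prod.ext ?_ ?_
    · show -((-a.2) a.1) + (-a.2) a.1 = 0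
      simp
    · exact neg_add_cancel a.2

/-- The natural action of the holomorph on `G`: `(g, α) • x = g + α x`. -/
def Hol.smul {G : Type*} [AddCommGroup G] (h : Hol G) (x : G) : G := h.1 + h.2 x

/-- A subgroup `H` of `Hol G` is regular if for every pair `x y : G` there is a
unique `h ∈ H` with `h • x = y`. -/
def Hol.IsRegular {G : Type*} [AddCommGroup G] (H : Subgroup (Hol G)) : Prop :=
  ∀ x y : G, ∃! h : Hol G, h ∈ H ∧ Hol.smul h x = y

/-- Two subgroups are conjugate if some element of the ambient group conjugates
one onto the other. -/
def ConjugateSubgroups {Γ : Type*} [Group Γ] (H₁ H₂ : Subgroup Γ) : Prop :=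
  ∃ g : Γ, H₁.map (MulAut.conj g).toMonoidHom = H₂

namespace HolCount

/-! ### Packed affine matrices

A `4 × 4` matrix of small naturals is packed into one natural number with digits in base `1024`.
With suitable digit positions a matrix product becomes one multiplication followed by masking. -/

/-- `4 × 4` matrices of natural numbers. -/
abbrev Mat : Type := Fin 4 → Fin 4 → ℕ

/-- Row `i` is read modulo `rowMod i`. -/
def rowMod : Fin 4 → ℕ := ![2, 2, 2, 16]

/-- Product of matrices, with rows reduced modulo `rowMod`. -/
def Mat.prod (x y : Mat) : Mat := fun i k => (∑ j, x i j * y j k) % rowMod i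

/-- All entries are less than `16`. -/
def Mat.Small (x : Mat) : Prop := ∀ i j, x i j ≤ 15

/-- Code of a left factor. -/
def lCode (x : Mat) : ℕ := ∑ p : Fin 4 × Fin 4, x p.1 p.2 * 1024 ^ (16 * p.1.val + p.2.val)
/-- Code of a middle factor; this is the main code. -/
def mCode (x : Mat) : ℕ := ∑ p : Fin 4 × Fin 4, x p.1 p.2 * 1024 ^ (3 - p.1.val + 4 * p.2.val)
/-- Code of a right factor. -/
def rCode (x : Mat) : ℕ :=
  ∑ p : Fin 4 × Fin 4, x p.1 p.2 * 1024 ^ (4 * (3 - p.1.val) + 21 * p.2.val + 5)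
/-- Code of an intermediate product. -/
def pCode (x : Mat) : ℕ := ∑ p : Fin 4 × Fin 4, x p.1 p.2 * 1024 ^ (16 * p.1.val + 3 + 4 * p.2.val)

/-- `pCode` of a product from the `lCode` and the `mCode` of the factors. -/
def mulP (x y : Nat) : Nat := Nat.land (Nat.mul x y)
  (nat_lit 66832626234760909192530122645818777701132872168256831139765100488635709105204267809199521816090381699041560534645099508960861433157388473923869284727880239477836604292658968755704027234172928)
/-- `mCode` of a product from the `pCode` and the `rCode` of the factors. -/
def mulM (p z : Nat) : Nat := Nat.mod (Nat.land (Nat.mul p z)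
  (nat_lit 335262962963018248142709989422268109549743223588570012045860469886611705081080920741210364782038112153998316032884318636802681500507100742948644185349867302345168011183250559379235389874103094864236522487055781518084682369469016101087101900310117232875800439662739834963089516746043590638700604259274786531557766571460746023873883453075649726792555340252342622226607278848566938906863822333542400))
  (nat_lit 1496577676626844588240573268701473812127674924007423)
/-- `lCode` from `pCode`. -/
def mulL (p : Nat) : Nat := Nat.shiftRight (Nat.land (Nat.mul p (nat_lit 1329227997022855913342108840860057600))
  (nat_lit 71831133587285732089915010650783509316364224221042864827489801596118315437573535213660648967297671429410488973947743462941793226363861330629069460128082506023428317604423861896352754179066220353945600)) (nat_lit 150)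
/-- `rCode` of the identity matrix. -/
def rOne : Nat :=
  nat_lit 5016456510113118655434598811035278955030765345404794096255000009480386948614397002970689562061750530816746827511065629900950252959129169121779933914463377633714085509805831516944393022714860705516250726400
/-- `lCode` of the identity matrix. -/
def lOne : Nat :=
  nat_lit 3351951982485649274893506249551461531869841455148100584175632538734651564960667312644746696187223091573539442212349321093550224132633497176229358782644225
/-- `mCode` of the identity matrix. -/
def mOne : Nat := nat_lit 1329227997022855913342108840860057600
/-- `mCode` of a triple product. -/
def mul3 (x y z : Nat) : Nat := mulM (mulP x y) z

theorem land_add_mul_pow {k A B d e : ℕ} (hA : A < 2 ^ k) (hB : B < 2 ^ k) :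
    Nat.land (A + d * 2 ^ k) (B + e * 2 ^ k) = Nat.land A B + Nat.land d e * 2 ^ k := by
  have hAB : Nat.land A B < 2 ^ k := Nat.and_lt_two_pow A hB
  apply Nat.eq_of_testBit_eq
  intro i
  change ((A + d * 2 ^ k) &&& (B + e * 2 ^ k)).testBit i = ((A &&& B) + (d &&& e) * 2 ^ k).testBit i
  change (A &&& B) < 2 ^ k at hAB
  rw [Nat.testBit_and, add_comm A, add_comm B, add_comm (A &&& B), mul_comm d, mul_comm e,
    mul_comm (d &&& e), Nat.testBit_two_pow_mul_add _ hA, Nat.testBit_two_pow_mul_add _ hB,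
    Nat.testBit_two_pow_mul_add _ hAB]
  split_ifs <;> simp

theorem sum_digits_lt {f : ℕ → ℕ} (hf : ∀ s, f s < 1024) (n : ℕ) :
    ∑ s ∈ Finset.range n, f s * 1024 ^ s < 1024 ^ n := by
  induction n with
  | zero => simp
  | succ n ih =>
    rw [Finset.sum_range_succ, pow_succ]
    have := hf n
    nlinarith [Nat.mul_le_mul_right (1024 ^ n) (Nat.le_sub_one_of_lt this)]

theorem land_sum_digits {f w : ℕ → ℕ} (hf : ∀ s, f s < 1024) (hw : ∀ s, w s < 1024) (n : ℕ) :
    Nat.land (∑ s ∈ Finset.range n, f s * 1024 ^ s) (∑ s ∈ Finset.range n, w s * 1024 ^ s) =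
      ∑ s ∈ Finset.range n, Nat.land (f s) (w s) * 1024 ^ s := by
  induction n with
  | zero => simp
  | succ n ih =>
    have h1 := sum_digits_lt hf n
    have h2 := sum_digits_lt hw n
    have e : (1024 : ℕ) ^ n = 2 ^ (10 * n) := by rw [pow_mul]; norm_num
    rw [Finset.sum_range_succ, Finset.sum_range_succ, Finset.sum_range_succ, ← ih]
    rw [e] at h1 h2 ⊢
    exact land_add_mul_pow h1 h2

theorem digit_sum_digits {f : ℕ → ℕ} (hf : ∀ s, f s < 1024) {n k : ℕ} (hk : k < n) :
    (∑ s ∈ Finset.range n, f s * 1024 ^ s) / 1024 ^ k % 1024 = f k := by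
  induction n with
  | zero => omega
  | succ n ih =>
    have hlt := sum_digits_lt hf n
    rw [Finset.sum_range_succ]
    rcases Nat.lt_succ_iff_lt_or_eq.1 hk with h | rfl
    · obtain ⟨d, rfl⟩ := Nat.exists_eq_add_of_lt h
      have : f (k + d + 1) * 1024 ^ (k + d + 1) = (f (k + d + 1) * 1024 ^ d * 1024) * 1024 ^ k := by
        ring
      rw [this, Nat.add_mul_div_right _ _ (by positivity), Nat.add_mul_mod_self_right]
      exact ih h
    · rw [Nat.add_mul_div_right _ _ (by positivity), Nat.div_eq_of_lt hlt, zero_add,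
        Nat.mod_eq_of_lt (hf k)]

/-- Regrouping a sum of monomials by exponents. -/
theorem sum_monomials_eq {ι : Type*} [Fintype ι] (t e : ι → ℕ) {n : ℕ} (he : ∀ i, e i < n) :
    ∑ i, t i * 1024 ^ e i =
      ∑ s ∈ Finset.range n, (∑ i with e i = s, t i) * 1024 ^ s := by
  rw [← Finset.sum_fiberwise_of_maps_to (s := Finset.univ) (t := Finset.range n) (g := e)
    (fun i _ => Finset.mem_range.2 (he i))]
  refine Finset.sum_congr rfl fun s _ => ?_
  rw [Finset.sum_mul]
  refine Finset.sum_congr rfl fun i hi => ?_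
  rw [(Finset.mem_filter.1 hi).2]

theorem sum_fiber_of_injective {κ : Type*} [Fintype κ] [DecidableEq κ] (W e : κ → ℕ)
    (he : Function.Injective e) (q : κ) : ∑ i with e i = e q, W i = W q := by
  rw [show (Finset.univ.filter fun i => e i = e q) = {q} by
    ext i; simp [he.eq_iff], Finset.sum_singleton]

/-- Masking a sum of monomials selects the exponents of the mask. -/
theorem land_monomials {ι κ : Type*} [Fintype ι] [Fintype κ] [DecidableEq κ]
    (t e : ι → ℕ) (W e' : κ → ℕ) (n : ℕ) (he : ∀ i, e i < n) (he' : ∀ q, e' q < n)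
    (hinj : Function.Injective e') (ht : ∀ i, t i ≤ 225) (hW : ∀ q, W q < 1024)
    (hc : ∀ s < n, (Finset.univ.filter fun i => e i = s).card ≤ 4) :
    Nat.land (∑ i, t i * 1024 ^ e i) (∑ q, W q * 1024 ^ e' q) =
      ∑ q, Nat.land (∑ i with e i = e' q, t i) (W q) * 1024 ^ e' q := by
  have hf : ∀ s, ∑ i with e i = s, t i < 1024 := by
    intro s
    by_cases hs : s < n
    · calc ∑ i with e i = s, t i ≤ (Finset.univ.filter fun i => e i = s).card • 225 :=
            Finset.sum_le_card_nsmul _ _ _ fun i _ => ht i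
        _ ≤ 4 * 225 := Nat.mul_le_mul_right _ (hc s hs)
        _ < 1024 := by norm_num
    · rw [Finset.filter_false_of_mem (p := fun i => e i = s) fun i _ h => hs (h ▸ he i)]
      simp
  have hw : ∀ s, ∑ q with e' q = s, W q < 1024 := by
    intro s
    by_cases hs : ∃ q, e' q = s
    · obtain ⟨q, rfl⟩ := hs
      rw [sum_fiber_of_injective W e' hinj]
      exact hW q
    · rw [Finset.filter_false_of_mem fun i _ h => hs ⟨i, h⟩]
      simp
  rw [sum_monomials_eq t e he, sum_monomials_eq W e' he', land_sum_digits hf hw,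
    ← Finset.sum_subset (s₁ := Finset.univ.image e')]
  · rw [Finset.sum_image fun _ _ _ _ h => hinj h]
    exact Finset.sum_congr rfl fun q _ => by rw [sum_fiber_of_injective W e' hinj]
  · intro s hs
    obtain ⟨q, -, rfl⟩ := Finset.mem_image.1 hs
    exact Finset.mem_range.2 (he' q)
  · intro s _ hs
    rw [Finset.filter_false_of_mem (p := fun q => e' q = s) fun i _ h =>
      hs (Finset.mem_image.2 ⟨i, Finset.mem_univ _, h⟩)]
    simp

theorem land_rowMod (a : ℕ) (i : Fin 4) : Nat.land a (rowMod i - 1) = a % rowMod i := by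
  have h2 := Nat.and_two_pow_sub_one_eq_mod a 1
  have h16 := Nat.and_two_pow_sub_one_eq_mod a 4
  fin_cases i
  · exact h2
  · exact h2
  · exact h2
  · exact h16

theorem Mat.prod_small (x y : Mat) : (x.prod y).Small := by
  intro i j
  have : rowMod i ≤ 16 ∧ 0 < rowMod i := by fin_cases i <;> simp [rowMod]
  have := Nat.mod_lt (∑ k, x i k * y k j) this.2
  simp only [Mat.prod]
  omega

/-- The masked product of packed matrices; `e` describes exponents of the product,
`e'` those selected by the mask. -/
theorem land_mul_codes (x y : Mat) (hx : x.Small) (hy : y.Small)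
    (e₁ e₂ e' : Fin 4 × Fin 4 → ℕ) (n : ℕ)
    (he : ∀ p q, e₁ p + e₂ q < n) (he' : ∀ q, e' q < n) (hinj : Function.Injective e')
    (hc : ∀ s < n, (Finset.univ.filter fun i : (Fin 4 × Fin 4) × (Fin 4 × Fin 4) =>
      e₁ i.1 + e₂ i.2 = s).card ≤ 4)
    (hfib : ∀ i : (Fin 4 × Fin 4) × (Fin 4 × Fin 4), ∀ q : Fin 4 × Fin 4,
      e₁ i.1 + e₂ i.2 = e' q ↔ i.1.1 = q.1 ∧ i.2.2 = q.2 ∧ i.1.2 = i.2.1) :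
    Nat.land ((∑ p, x p.1 p.2 * 1024 ^ e₁ p) * ∑ q, y q.1 q.2 * 1024 ^ e₂ q)
      (∑ q : Fin 4 × Fin 4, (rowMod q.1 - 1) * 1024 ^ e' q) =
      ∑ q : Fin 4 × Fin 4, x.prod y q.1 q.2 * 1024 ^ e' q := by
  have h1 : (∑ p, x p.1 p.2 * 1024 ^ e₁ p) * ∑ q, y q.1 q.2 * 1024 ^ e₂ q =
      ∑ i : (Fin 4 × Fin 4) × (Fin 4 × Fin 4),
        (x i.1.1 i.1.2 * y i.2.1 i.2.2) * 1024 ^ (e₁ i.1 + e₂ i.2) := by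
    rw [Finset.sum_mul_sum, ← Finset.sum_product', Finset.univ_product_univ]
    refine Finset.sum_congr rfl fun i _ => ?_
    rw [pow_add]; ring
  rw [h1, land_monomials _ _ _ _ n (fun i => he _ _) he' hinj
    (fun i => Nat.mul_le_mul (hx _ _) (hy _ _)) _ hc]
  · refine Finset.sum_congr rfl fun q _ => ?_
    rw [land_rowMod, Mat.prod]
    refine congrArg (fun a => a % rowMod q.1 * 1024 ^ e' q) (Eq.symm ?_)
    refine Finset.sum_bij (fun j _ => ((q.1, j), (j, q.2))) ?_ ?_ ?_ ?_
    · intro j _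
      simp [hfib]
    · intro j _ k _ h
      simpa using h
    · rintro ⟨⟨i, j⟩, ⟨j', k⟩⟩ h
      simp only [Finset.mem_filter, hfib] at h
      obtain ⟨-, rfl, rfl, rfl⟩ := h
      exact ⟨j, Finset.mem_univ _, rfl⟩
    · intro j _
      rfl
  · intro q
    have : ∀ i, rowMod i - 1 < 1024 := by intro i; fin_cases i <;> simp [rowMod]
    exact this _

theorem mulP_def (x y : ℕ) : mulP x y = Nat.land (x * y)
    66832626234760909192530122645818777701132872168256831139765100488635709105204267809199521816090381699041560534645099508960861433157388473923869284727880239477836604292658968755704027234172928 := rfl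

theorem mulM_def (p z : ℕ) : mulM p z = Nat.land (p * z)
    335262962963018248142709989422268109549743223588570012045860469886611705081080920741210364782038112153998316032884318636802681500507100742948644185349867302345168011183250559379235389874103094864236522487055781518084682369469016101087101900310117232875800439662739834963089516746043590638700604259274786531557766571460746023873883453075649726792555340252342622226607278848566938906863822333542400 % 1496577676626844588240573268701473812127674924007423 := rfl

theorem mulL_def (p : ℕ) : mulL p = Nat.shiftRight (Nat.land (p * 1329227997022855913342108840860057600)
    71831133587285732089915010650783509316364224221042864827489801596118315437573535213660648967297671429410488973947743462941793226363861330629069460128082506023428317604423861896352754179066220353945600) 150 := rfl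

theorem mulP_eq (x y : Mat) (hx : x.Small) (hy : y.Small) :
    mulP (lCode x) (mCode y) = pCode (x.prod y) := by
  have := land_mul_codes x y hx hy (fun p => 16 * p.1.val + p.2.val)
    (fun p => 3 - p.1.val + 4 * p.2.val) (fun p => 16 * p.1.val + 3 + 4 * p.2.val) 80
    (by decide +kernel) (by decide +kernel) (by decide +kernel) (by decide +kernel)
    (by decide +kernel)
  have hmask : (∑ q : Fin 4 × Fin 4, (rowMod q.1 - 1) *
      1024 ^ (16 * q.1.val + 3 + 4 * q.2.val) : ℕ) =
      66832626234760909192530122645818777701132872168256831139765100488635709105204267809199521816090381699041560534645099508960861433157388473923869284727880239477836604292658968755704027234172928 := by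
    decide +kernel
  rw [hmask] at this
  rw [mulP_def]
  exact this

theorem land_pCode_mul_rCode (x y : Mat) (hx : x.Small) (hy : y.Small) :
    Nat.land (pCode x * rCode y)
      335262962963018248142709989422268109549743223588570012045860469886611705081080920741210364782038112153998316032884318636802681500507100742948644185349867302345168011183250559379235389874103094864236522487055781518084682369469016101087101900310117232875800439662739834963089516746043590638700604259274786531557766571460746023873883453075649726792555340252342622226607278848566938906863822333542400 =
      ∑ p : Fin 4 × Fin 4, x.prod y p.1 p.2 * 1024 ^ (16 * p.1.val + 20 + 21 * p.2.val) := by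
  have := land_mul_codes x y hx hy (fun p => 16 * p.1.val + 3 + 4 * p.2.val)
    (fun p => 4 * (3 - p.1.val) + 21 * p.2.val + 5) (fun p => 16 * p.1.val + 20 + 21 * p.2.val) 160
    (by decide +kernel) (by decide +kernel) (by decide +kernel) (by decide +kernel)
    (by decide +kernel)
  have hmask : (∑ q : Fin 4 × Fin 4, (rowMod q.1 - 1) *
      1024 ^ (16 * q.1.val + 20 + 21 * q.2.val) : ℕ) =
      335262962963018248142709989422268109549743223588570012045860469886611705081080920741210364782038112153998316032884318636802681500507100742948644185349867302345168011183250559379235389874103094864236522487055781518084682369469016101087101900310117232875800439662739834963089516746043590638700604259274786531557766571460746023873883453075649726792555340252342622226607278848566938906863822333542400 := by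
    decide +kernel
  rw [hmask] at this
  exact this

theorem sum_mod_eq_mCode (z : Mat) (hs : z.Small) (N : ℕ)
    (hk : ∀ p : Fin 4 × Fin 4, (1024 : ℕ) ^ (16 * p.1.val + 20 + 21 * p.2.val) % N =
      1024 ^ (3 - p.1.val + 4 * p.2.val) % N)
    (hlt : ∑ p : Fin 4 × Fin 4, 15 * 1024 ^ (3 - p.1.val + 4 * p.2.val) < N) :
    (∑ p : Fin 4 × Fin 4, z p.1 p.2 * 1024 ^ (16 * p.1.val + 20 + 21 * p.2.val)) % N =
      mCode z := by
  have hmod : (∑ p : Fin 4 × Fin 4, z p.1 p.2 * 1024 ^ (16 * p.1.val + 20 + 21 * p.2.val)) ≡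
      (∑ p : Fin 4 × Fin 4, z p.1 p.2 * 1024 ^ (3 - p.1.val + 4 * p.2.val)) [MOD N] :=
    Nat.ModEq.sum fun p _ => Nat.ModEq.mul_left _ (hk p)
  unfold Nat.ModEq at hmod
  rw [hmod, mCode]
  refine Nat.mod_eq_of_lt (lt_of_le_of_lt ?_ hlt)
  exact Finset.sum_le_sum fun p _ => Nat.mul_le_mul_right _ (hs _ _)

theorem mulM_eq (x y : Mat) (hx : x.Small) (hy : y.Small) :
    mulM (pCode x) (rCode y) = mCode (x.prod y) := by
  rw [mulM_def, land_pCode_mul_rCode x y hx hy]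
  exact sum_mod_eq_mCode _ (Mat.prod_small x y) _ (by decide +kernel) (by decide +kernel)

/-- The identity matrix. -/
def Mat.one : Mat := fun i j => if i = j then 1 else 0

theorem Mat.one_small : Mat.one.Small := by
  intro i j
  unfold Mat.one
  split_ifs <;> simp

theorem Mat.sum_mul_one (x : Mat) (i k : Fin 4) : ∑ j, x i j * Mat.one j k = x i k := by
  simp [Mat.one]

theorem mulL_eq (x : Mat) (hx : ∀ i j, x i j < rowMod i) : mulL (pCode x) = lCode x := by
  have hsm : x.Small := by
    intro i j
    have : rowMod i ≤ 16 := by fin_cases i <;> simp [rowMod]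
    have := hx i j
    omega
  have := land_mul_codes x Mat.one hsm Mat.one_small (fun p => 16 * p.1.val + 3 + 4 * p.2.val)
    (fun p => 4 * (3 - p.1.val) + p.2.val) (fun p => 16 * p.1.val + 15 + p.2.val) 160
    (by decide +kernel) (by decide +kernel) (by decide +kernel) (by decide +kernel)
    (by decide +kernel)
  have hp : x.prod Mat.one = x := by
    funext i k
    rw [Mat.prod, Mat.sum_mul_one, Nat.mod_eq_of_lt (hx i k)]
  have hmask : (∑ q : Fin 4 × Fin 4, (rowMod q.1 - 1) *
      1024 ^ (16 * q.1.val + 15 + q.2.val) : ℕ) =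
      71831133587285732089915010650783509316364224221042864827489801596118315437573535213660648967297671429410488973947743462941793226363861330629069460128082506023428317604423861896352754179066220353945600 := by
    decide +kernel
  have hone : (∑ q : Fin 4 × Fin 4, Mat.one q.1 q.2 * 1024 ^ (4 * (3 - q.1.val) + q.2.val) : ℕ) =
      1329227997022855913342108840860057600 := by
    decide +kernel
  rw [hp, hmask, hone] at this
  rw [mulL_def, pCode, lCode, this]
  have hfac : ∑ p : Fin 4 × Fin 4, x p.1 p.2 * 1024 ^ (16 * p.1.val + 15 + p.2.val) =
      (∑ p : Fin 4 × Fin 4, x p.1 p.2 * 1024 ^ (16 * p.1.val + p.2.val)) * 2 ^ 150 := by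
    rw [Finset.sum_mul]
    refine Finset.sum_congr rfl fun p _ => ?_
    rw [show (2 : ℕ) ^ 150 = 1024 ^ 15 by norm_num]
    ring
  rw [hfac]
  exact (Nat.shiftRight_eq_div_pow _ _).trans (Nat.mul_div_cancel _ (by positivity))

/-- Digits of the main code. -/
theorem mCode_digit (x : Mat) (hx : x.Small) (p : Fin 4 × Fin 4) :
    mCode x / 1024 ^ (3 - p.1.val + 4 * p.2.val) % 1024 = x p.1 p.2 := by
  have hinj : Function.Injective fun p : Fin 4 × Fin 4 => 3 - p.1.val + 4 * p.2.val := by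
    decide +kernel
  unfold mCode
  rw [sum_monomials_eq _ _ (n := 16) (by decide +kernel), digit_sum_digits]
  · exact sum_fiber_of_injective (fun p : Fin 4 × Fin 4 => x p.1 p.2) _ hinj p
  · intro s
    by_cases hs : ∃ q : Fin 4 × Fin 4, 3 - q.1.val + 4 * q.2.val = s
    · obtain ⟨q, rfl⟩ := hs
      rw [sum_fiber_of_injective (fun p : Fin 4 × Fin 4 => x p.1 p.2) _ hinj q]
      have := hx q.1 q.2
      omega
    · rw [Finset.filter_false_of_mem fun i _ h => hs ⟨i, h⟩]
      simp
  · revert p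
    decide +kernel

theorem mCode_injective {x y : Mat} (hx : x.Small) (hy : y.Small) (h : mCode x = mCode y) :
    x = y := by
  funext i j
  have := mCode_digit x hx (i, j)
  rw [h, mCode_digit y hy (i, j)] at this
  exact this.symm

theorem lOne_eq : lOne = lCode Mat.one := by decide +kernel
theorem rOne_eq : rOne = rCode Mat.one := by decide +kernel
theorem mOne_eq : mOne = mCode Mat.one := by decide +kernel

/-! ### Codes of elements of the holomorph -/

/-- The group `C₂ × C₂ × C₁₆`. -/
abbrev G : Type := ZMod 2 × ZMod 2 × ZMod 16

/-- First generator. -/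
def ga : G := (1, 0, 0)
/-- Second generator. -/
def gb : G := (0, 1, 0)
/-- Third generator. -/
def gc : G := (0, 0, 1)

theorem eq_combination (y : G) :
    y = y.1.val • ga + (y.2.1.val • gb + y.2.2.val • gc) := by
  obtain ⟨p, q, r⟩ := y
  simp [ga, gb, gc]

theorem map_eq_combination (f : G →+ G) (y : G) :
    f y = y.1.val • f ga + (y.2.1.val • f gb + y.2.2.val • f gc) := by
  conv_lhs => rw [eq_combination y]
  simp only [map_add, map_nsmul]

/-- The matrix of the affine map `y ↦ x + f y`. -/
def affMat (x : G) (f : G →+ G) : Mat := fun i j =>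
  ![![1, 0, 0, 0] j, (![x, f ga, f gb, f gc] j).1.val, (![x, f ga, f gb, f gc] j).2.1.val,
    (![x, f ga, f gb, f gc] j).2.2.val] i

theorem forall_fin_four {P : Fin 4 → Prop} (h0 : P 0) (h1 : P 1) (h2 : P 2) (h3 : P 3) (i : Fin 4) :
    P i := by
  fin_cases i <;> assumption

/-- The columns of the matrix of an affine map. -/
def affCol (x : G) (f : G →+ G) : Fin 4 → G := ![x, f ga, f gb, f gc]

theorem affMat_one (x : G) (f : G →+ G) (j : Fin 4) : affMat x f 1 j = (affCol x f j).1.val := rfl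
theorem affMat_two (x : G) (f : G →+ G) (j : Fin 4) : affMat x f 2 j = (affCol x f j).2.1.val := rfl
theorem affMat_three (x : G) (f : G →+ G) (j : Fin 4) :
    affMat x f 3 j = (affCol x f j).2.2.val := rfl

theorem affMat_lt (x : G) (f : G →+ G) (i j : Fin 4) : affMat x f i j < rowMod i := by
  revert i
  refine forall_fin_four ?_ ?_ ?_ ?_
  · fin_cases j <;> simp [affMat, rowMod]
  · rw [affMat_one]
    exact ZMod.val_lt (n := 2) _
  · rw [affMat_two]
    exact ZMod.val_lt (n := 2) _
  · rw [affMat_three]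
    exact ZMod.val_lt (n := 16) _

theorem affMat_small (x : G) (f : G →+ G) : (affMat x f).Small := by
  intro i j
  have h1 : rowMod i ≤ 16 := by fin_cases i <;> simp [rowMod]
  have := affMat_lt x f i j
  omega

theorem val_eq_mod {n : ℕ} {u : ZMod n} {k : ℕ} (h : u = k) : u.val = k % n := by
  rw [h, ZMod.val_natCast]

theorem affMat_mul (x y : G) (f g : G →+ G) :
    affMat (x + f y) (f.comp g) = (affMat x f).prod (affMat y g) := by
  have h1 := map_eq_combination f y
  have h2 := map_eq_combination f (g ga)
  have h3 := map_eq_combination f (g gb)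
  have h4 := map_eq_combination f (g gc)
  have hcol : ∀ j, affCol (x + f y) (f.comp g) j =
      (if j = 0 then x else 0) + ((affCol y g j).1.val • f ga +
        ((affCol y g j).2.1.val • f gb + (affCol y g j).2.2.val • f gc)) := by
    refine forall_fin_four ?_ ?_ ?_ ?_
    · exact congrArg (x + ·) h1
    · exact h2.trans (zero_add _).symm
    · exact h3.trans (zero_add _).symm
    · exact h4.trans (zero_add _).symm
  have htop : ∀ j, affMat y g 0 j = if j = 0 then 1 else 0 := by
    refine forall_fin_four ?_ ?_ ?_ ?_ <;> rfl
  funext i j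
  revert i
  refine forall_fin_four ?_ ?_ ?_ ?_
  · fin_cases j <;> simp [affMat, Mat.prod, rowMod, Fin.sum_univ_four]
  · rw [affMat_one, hcol]
    refine (val_eq_mod (n := 2) ?_).trans (congrArg (· % 2) rfl)
    rw [Fin.sum_univ_four, htop]
    simp [affMat_one, affMat_two, affMat_three, affCol, mul_comm, add_assoc]
    split_ifs <;> rfl
  · rw [affMat_two, hcol]
    refine (val_eq_mod (n := 2) ?_).trans (congrArg (· % 2) rfl)
    rw [Fin.sum_univ_four, htop]
    simp [affMat_one, affMat_two, affMat_three, affCol, mul_comm, add_assoc]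
    split_ifs <;> rfl
  · rw [affMat_three, hcol]
    refine (val_eq_mod (n := 16) ?_).trans (congrArg (· % 16) rfl)
    rw [Fin.sum_univ_four, htop]
    simp [affMat_one, affMat_two, affMat_three, affCol, mul_comm, add_assoc]
    split_ifs <;> rfl

/-- Code of the affine map `y ↦ x + f y`. -/
def affEnc (x : G) (f : G →+ G) : ℕ := mCode (affMat x f)

theorem affEnc_injective {x y : G} {f g : G →+ G} (h : affEnc x f = affEnc y g) :
    x = y ∧ f = g := by
  have h := mCode_injective (affMat_small x f) (affMat_small y g) h
  have hx : ∀ j, ![x, f ga, f gb, f gc] j = ![y, g ga, g gb, g gc] j := by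
    intro j
    refine Prod.ext ?_ (Prod.ext ?_ ?_)
    · exact ZMod.val_injective 2 (congrFun (congrFun h 1) j)
    · exact ZMod.val_injective 2 (congrFun (congrFun h 2) j)
    · exact ZMod.val_injective 16 (congrFun (congrFun h 3) j)
  refine ⟨hx 0, ?_⟩
  ext1 v
  rw [map_eq_combination f, map_eq_combination g, show f ga = g ga from hx 1,
    show f gb = g gb from hx 2, show f gc = g gc from hx 3]

theorem affMat_id : affMat 0 (AddMonoidHom.id G) = Mat.one := by
  funext i j
  fin_cases i <;> fin_cases j <;> simp [affMat, Mat.one, ga, gb, gc, ZMod.val_one_eq_one_mod]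

/-- The matrix of an element of the holomorph. -/
def holMat (h : Hol G) : Mat := affMat h.1 h.2.toAddMonoidHom

theorem holMat_small (h : Hol G) : (holMat h).Small := affMat_small _ _

/-- Main code of an element of the holomorph. -/
def enc (h : Hol G) : ℕ := mCode (holMat h)
/-- Code as a left factor. -/
def encL (h : Hol G) : ℕ := lCode (holMat h)
/-- Code as a right factor. -/
def encR (h : Hol G) : ℕ := rCode (holMat h)
/-- Code of an intermediate product. -/
def encP (h : Hol G) : ℕ := pCode (holMat h)

theorem holMat_mul (g h : Hol G) : holMat (g * h) = (holMat g).prod (holMat h) :=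
  affMat_mul g.1 h.1 g.2.toAddMonoidHom h.2.toAddMonoidHom

theorem holMat_one : holMat 1 = Mat.one := affMat_id

theorem mulP_enc (g h : Hol G) : mulP (encL g) (enc h) = encP (g * h) := by
  rw [encL, enc, mulP_eq _ _ (holMat_small _) (holMat_small _), encP, holMat_mul]

theorem mulM_enc (g h : Hol G) : mulM (encP g) (encR h) = enc (g * h) := by
  rw [encP, encR, mulM_eq _ _ (holMat_small _) (holMat_small _), enc, holMat_mul]

theorem mulL_enc (g : Hol G) : mulL (encP g) = encL g :=
  mulL_eq _ (affMat_lt _ _)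

theorem lOne_enc : lOne = encL 1 := by rw [encL, holMat_one, lOne_eq]
theorem rOne_enc : rOne = encR 1 := by rw [encR, holMat_one, rOne_eq]
theorem mOne_enc : mOne = enc 1 := by rw [enc, holMat_one, mOne_eq]

theorem mul3_enc (f g h : Hol G) : mul3 (encL f) (enc g) (encR h) = enc (f * g * h) := by
  rw [mul3, mulP_enc, mulM_enc]

theorem mul3_one_enc (f g : Hol G) : mul3 (encL f) (enc g) rOne = enc (f * g) := by
  rw [rOne_enc, mul3_enc, mul_one]

theorem enc_injective : Function.Injective enc := by
  intro g h e
  obtain ⟨h1, h2⟩ := affEnc_injective (x := g.1) (y := h.1) (f := g.2.toAddMonoidHom)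
    (g := h.2.toAddMonoidHom) e
  refine Prod.ext h1 ?_
  ext1 v
  exact DFunLike.congr_fun h2 v

/-- Code of a column. -/
def colCode (v : G) : ℕ := v.2.2.val + 1024 * v.2.1.val + 1048576 * v.1.val

theorem affEnc_eq (x : G) (f : G →+ G) : affEnc x f =
    colCode x + 1073741824 + 1099511627776 * (colCode (f ga) +
      1099511627776 * (colCode (f gb) + 1099511627776 * colCode (f gc))) := by
  simp only [affEnc, mCode, affMat, Fintype.sum_prod_type, Fin.sum_univ_four, colCode]
  simp only [Matrix.cons_val, Fin.isValue, Fin.coe_ofNat_eq_mod]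
  norm_num
  ring

/-- Position of an element of `G` in arrays. -/
def slot (v : G) : ℕ := v.2.2.val + 16 * v.2.1.val + 32 * v.1.val

theorem slot_injective : Function.Injective slot := by
  rintro ⟨p, q, r⟩ ⟨p', q', r'⟩ h
  have := ZMod.val_lt p; have := ZMod.val_lt p'; have := ZMod.val_lt q
  have := ZMod.val_lt q'; have := ZMod.val_lt r; have := ZMod.val_lt r'
  simp only [slot] at h
  have h1 : p = p' := ZMod.val_injective 2 (by omega)
  have h2 : q = q' := ZMod.val_injective 2 (by omega)
  have h3 : r = r' := ZMod.val_injective 16 (by omega)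
  rw [h1, h2, h3]

theorem colCode_lt (v : G) : colCode v < 2 ^ 21 := by
  have := ZMod.val_lt v.1; have := ZMod.val_lt v.2.1; have := ZMod.val_lt v.2.2
  simp only [colCode]
  omega

/-- The slot of an encoded element. -/
def idxC (h : Nat) : Nat := Nat.mod (Nat.mod h (nat_lit 1073741824)) (nat_lit 112)

theorem idxC_def (h : ℕ) : idxC h = h % 1073741824 % 112 := rfl

theorem idxC_enc (h : Hol G) : idxC (enc h) = slot h.1 := by
  have e : enc h = affEnc h.1 h.2.toAddMonoidHom := rfl
  have := ZMod.val_lt h.1.1; have := ZMod.val_lt h.1.2.1; have := ZMod.val_lt h.1.2.2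
  rw [idxC_def, e, affEnc_eq, slot]
  generalize colCode (h.2.toAddMonoidHom ga) + _ = k
  have h1 : colCode h.1 + 1073741824 + 1099511627776 * k =
      colCode h.1 + 1073741824 * (1 + 1024 * k) := by ring
  have h2 := colCode_lt h.1
  have h3 : colCode h.1 % 1073741824 = colCode h.1 := Nat.mod_eq_of_lt (by omega)
  rw [h1, Nat.add_mul_mod_self_left, h3, colCode]
  omega

theorem enc_pos (h : Hol G) : enc h ≠ 0 := by
  have e : enc h = affEnc h.1 h.2.toAddMonoidHom := rfl
  rw [e, affEnc_eq]
  omega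

theorem enc_lt (h : Hol G) : enc h < 2 ^ 160 := by
  have e : enc h = affEnc h.1 h.2.toAddMonoidHom := rfl
  have h0 := colCode_lt h.1
  have h1 := colCode_lt (h.2.toAddMonoidHom ga)
  have h2 := colCode_lt (h.2.toAddMonoidHom gb)
  have h3 := colCode_lt (h.2.toAddMonoidHom gc)
  rw [e, affEnc_eq]
  omega

/-- Translations by `k` change only the first column. -/
theorem enc_translate (k : G) (α : AddAut G) : enc (k, α) = enc (0, α) + colCode k := by
  have e : ∀ x : G, enc (x, α) = affEnc x α.toAddMonoidHom := fun _ => rfl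
  rw [e, e, affEnc_eq, affEnc_eq, show colCode (0 : G) = 0 from rfl]
  omega

/-- Tests whether `α gb` has trivial first component. -/
def inQC (h : Nat) : Bool :=
  Nat.beq (Nat.land h (nat_lit 1267650600228229401496703205376)) (nat_lit 0)

theorem inQC_enc (h : Hol G) : inQC (enc h) = true ↔ (h.2 gb).1 = 0 := by
  have hd := mCode_digit (holMat h) (affMat_small _ _) (1, 2)
  have hx : holMat h 1 2 = (h.2 gb).1.val := rfl
  rw [hx] at hd
  have hlt := ZMod.val_lt (h.2 gb).1
  have key : Nat.land (enc h) (2 ^ 100) = 0 ↔ (h.2 gb).1.val = 0 := by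
    change (enc h &&& 2 ^ 100) = 0 ↔ _
    rw [Nat.and_two_pow, ← hd]
    change _ ↔ enc h / 1024 ^ 10 % 1024 = 0
    rw [Nat.testBit_eq_decide_div_mod_eq]
    have : (1024 : ℕ) ^ 10 = 2 ^ 100 := by norm_num
    rw [← this]
    change enc h / 1024 ^ 10 % 1024 = _ at hd
    generalize enc h / 1024 ^ 10 = d at hd ⊢
    by_cases h1 : d % 2 = 1
    · simp [h1]
      omega
    · simp [h1]
      omega
  have e : inQC (enc h) = Nat.beq (Nat.land (enc h) (2 ^ 100)) 0 := rfl
  rw [e, Nat.beq_eq, key, ZMod.val_eq_zero]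

/-! ### The enumeration -/

/-- Reads a slot of an array of 160-bit words. -/
def getC (arr j : Nat) : Nat :=
  Nat.mod (Nat.shiftRight arr (Nat.mul (nat_lit 160) j))
    (nat_lit 1461501637330902918203684832716283019655932542976)
/-- Writes a word into an empty slot. -/
def setC (arr j w : Nat) : Nat := Nat.lor arr (Nat.shiftLeft w (Nat.mul (nat_lit 160) j))
/-- Membership of an encoded element in an array indexed by positions. -/
def membC (arr w : Nat) : Bool := Nat.beq (getC arr (idxC w)) w
/-- An array entry is empty or equal to the given word. -/
def softE (e w : Nat) : Bool := Bool.rec (Nat.beq e (nat_lit 0)) true (Nat.beq e w)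
/-- The slot of an encoded element is empty or contains this element. -/
def softC (arr w : Nat) : Bool := softE (getC arr (idxC w)) w
/-- Lazy conjunction. -/
def andC (x y : Bool) : Bool := Bool.rec false y x
/-- Lazy conditional. -/
def iteC {α : Type} (x : Bool) (y z : α) : α := Bool.rec z y x
/-- Lazy universal quantification over a list. -/
def allC {α : Type} (p : α → Bool) (l : List α) : Bool :=
  List.rec true (fun a _ ih => andC (p a) ih) l
/-- Sum over a list. -/
def sumL {α : Type} (f : α → Nat) (l : List α) : Nat :=
  List.rec (nat_lit 0) (fun a _ ih => Nat.add (f a) ih) l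

/-- The codes of an element as a left factor and as a middle factor, and the code of its inverse
as a right factor. -/
structure CE where
  l : Nat
  m : Nat
  r : Nat

/-- The codes of an automorphism and of its inverse, and the slots of the preimages of the
six distinguished elements. -/
structure TE where
  s : Nat
  si : Nat
  p8 : Nat
  p4 : Nat
  p2 : Nat
  pa : Nat
  pb : Nat
  pc : Nat

/-- The codes of an element, of its inverse and of its powers. -/
structure GE where
  l : Nat
  m : Nat
  r : Nat
  g2 : Nat
  g4 : Nat
  g8 : Nat

/-- A partial subgroup with its array, elements and generators, the automorphisms still to be
compared with, and the possible continuations at the last level. -/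
structure Node where
  arr : Nat
  els : List Nat
  gs : List Nat
  T : List TE
  Γ : List GE

/-- Tests whether the conjugate of `g` lies in the array. -/
def conjIn (arr h hi g : Nat) : Bool := membC arr (mul3 h g hi)
/-- Tests whether an element normalizes a subgroup and has its square there. -/
def candC (arr : Nat) (gs : List Nat) (h : CE) : Bool :=
  andC (membC arr (mul3 h.l h.m rOne)) (allC (conjIn arr h.l h.r) gs)

/-- Adds the left codes of the products `x h` to a list. -/
def mapMul (h : Nat) (l : List Nat) (tl : List Nat) : List Nat :=
  List.rec tl (fun x _ ih => List.cons (mulL (mulP x h)) ih) l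
/-- Adds the products `x h` to an array. -/
def fillC (h : Nat) (l : List Nat) (arr : Nat) : Nat :=
  List.rec (fun arr => arr)
    (fun x _ ih arr => (fun y => ih (setC arr (idxC y) y)) (mul3 x h rOne)) l arr

/-- Compares an entry with the corresponding entry of the conjugates by the automorphisms in `T`;
returns `0` if some conjugate has a smaller entry, and otherwise
continues with the automorphisms for which no strict inequality was found. -/
def chkT (arr v : Nat) (pos : TE → Nat) (cont : List TE → Nat) (T : List TE) : List TE → Nat :=
  List.rec cont (fun t _ ih acc =>
    (fun e => iteC (Nat.beq e (nat_lit 0)) (ih (List.cons t acc))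
      ((fun w => iteC (Nat.beq w v) (ih (List.cons t acc))
        (iteC (Nat.ble v w) (ih acc) (nat_lit 0)))
       (mul3 t.s e t.si))) (getC arr (pos t))) T

/-- Filters a list and continues if the result is not empty. -/
def filtG (p : GE → Bool) (cont : List GE → Nat) (Γ : List GE) : List GE → Nat :=
  List.rec (fun acc => List.rec (nat_lit 0) (fun _ _ _ => cont acc) acc) (fun g _ ih acc =>
    iteC (p g) (ih (List.cons g acc)) (ih acc)) Γ

/-- Necessary conditions for an element `g` to be compatible with a subgroup containing `h`. -/
def okG (arr h : Nat) (g : GE) : Bool :=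
  andC (softC arr g.g2) (andC (softC arr g.g4) (andC (softC arr g.g8)
   ((fun p => andC (softC arr (mulM p g.r))
      ((fun p => andC (softC arr (mulM p rOne)) (softC arr (mul3 (mulL p) (mulM p rOne) rOne)))
         (mulP (mulL p) (mulM p rOne)))) (mulP g.l h))))

/-- Necessary and sufficient conditions at the last level. -/
def okX (q : Bool) (arr : Nat) (gs : List Nat) (g : GE) : Bool :=
  andC (iteC (andC q (inQC g.m)) false true)
    (andC (membC arr g.g2) (allC (conjIn arr g.l g.r) gs))

/-- The node of the subgroup generated by a subgroup and `h`. -/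
def child (h : Nat) (n : Node) (T : List TE) (Γ : List GE) : Node :=
  Node.mk (fillC h n.els n.arr) (mapMul h n.els n.els) (List.cons h n.gs) T Γ

/-- Continuation with `h`. -/
def tryS (ka : Nat) (pos : TE → Nat) (cont : Node → Nat) (n : Node) (h : Nat) : Nat :=
  (fun arr => chkT arr (getC arr ka) pos (fun T => filtG (okG arr h)
    (fun Γ => cont (child h n T Γ)) n.Γ List.nil) n.T List.nil) (fillC h n.els n.arr)

/-- Adds one generator. -/
def stepS (L : List CE) (ka : Nat) (pos : TE → Nat) (cont : Node → Nat) (n : Node) : Nat :=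
  sumL (fun h => iteC (candC n.arr n.gs h) (tryS ka pos cont n h.m) (nat_lit 0)) L

/-- Continuation with `h` at the fifth level. -/
def try5 (nq : Bool) (cont : Node → Nat) (n : Node) (h : Nat) : Nat :=
  (fun arr => filtG (okX (andC nq (allC inQC (List.cons h n.gs))) arr (List.cons h n.gs)) (fun Γ =>
     chkT arr (getC arr (nat_lit 32)) TE.pa (fun T => chkT arr (getC arr (nat_lit 16)) TE.pb
       (fun T => cont (child h n T Γ)) T List.nil) n.T List.nil) n.Γ List.nil)
    (fillC h n.els n.arr)

/-- Adds one generator at the fifth level. -/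
def step5 (L : List CE) (nq : Bool) (cont : Node → Nat) (n : Node) : Nat :=
  sumL (fun h => iteC (candC n.arr n.gs h) (try5 nq cont n h.m) (nat_lit 0)) L

/-- The array with entries `x` in the slots of the elements `x • c`. -/
def tabC (l : List Nat) : Nat :=
  List.rec (nat_lit 0) (fun x _ ih =>
    setC ih (idxC (mul3 x (nat_lit 1329227997022855913342108840860057601) rOne))
      (mul3 x mOne rOne)) l
/-- The data needed for the comparison with conjugates at the last level. -/
def preT (tab : Nat) (T : List TE) : List CE :=
  List.rec List.nil (fun t _ ih =>
    List.cons (CE.mk (mulL (mulP t.s (getC tab t.pc))) (nat_lit 0) t.si) ih) T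
/-- Tests for minimality at the last level. -/
def minG (P : List CE) (g : Nat) : Bool := allC (fun l => Nat.ble g (mul3 l.l g l.r)) P
/-- Counts the minimal elements. -/
def countG (P : List CE) (Γ : List GE) : Nat :=
  List.rec (nat_lit 0) (fun g _ ih => iteC (minG P g.m) (Nat.succ ih) ih) Γ
/-- Counts the canonical extensions at the last level. -/
def fin6 (n : Node) : Nat := countG (preT (tabC n.els) n.T) n.Γ

/-! ### The lists of automorphisms -/

/-- A digit of a code. -/
def digC (m e : Nat) : Nat := Nat.mod (Nat.shiftRight m (Nat.mul 10 e)) 1024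
/-- Conversion to a left factor. -/
def toL (m : Nat) : Nat := mulL (mulP lOne m)
/-- Conversion to a right factor. -/
def toR (m : Nat) : Nat :=
  digC m 3 * 2^170 + digC m 7 * 2^380 + digC m 11 * 2^590 + digC m 15 * 2^800 +
  digC m 2 * 2^130 + digC m 6 * 2^340 + digC m 10 * 2^550 + digC m 14 * 2^760 +
  digC m 1 * 2^90 + digC m 5 * 2^300 + digC m 9 * 2^510 + digC m 13 * 2^720 +
  digC m 0 * 2^50 + digC m 4 * 2^260 + digC m 8 * 2^470 + digC m 12 * 2^680

/-- Product of codes. -/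
def mul2 (x y : Nat) := mul3 (toL x) y rOne
/-- Square of a code. -/
def pw2 (x : Nat) := mul2 x x
/-- Inverse of the code of an automorphism. -/
def invC (x : Nat) : Nat := mul2 (pw2 (pw2 (pw2 x))) (mul2 x (pw2 x))

/-- The codes of an automorphism and of its inverse. -/
structure AE where
  a : Nat
  ai : Nat
/-- Computes the inverse. -/
def mkAE (x : Nat) : AE := AE.mk x (invC x)
/-- The data of the element with translation part `k`. -/
def mkCE (k nk : Nat) (l : AE) : CE :=
  CE.mk (toL (Nat.add l.a k)) (Nat.add l.a k) (toR (mul2 l.ai (Nat.add mOne nk)))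
/-- The data of an automorphism used for the comparisons. -/
def mkTE (l : AE) : TE := TE.mk (toL l.a) (toR l.ai)
  (idxC (mul2 l.ai (Nat.add mOne 8))) (idxC (mul2 l.ai (Nat.add mOne 4)))
  (idxC (mul2 l.ai (Nat.add mOne 2))) (idxC (mul2 l.ai (Nat.add mOne 1048576)))
  (idxC (mul2 l.ai (Nat.add mOne 1024))) (idxC (mul2 l.ai (Nat.add mOne 1)))
/-- The data of the elements of the last level. -/
def mkGE (l : AE) : GE :=
  (fun g => (fun g2 => (fun g4 => GE.mk (toL g) g (toR (mul2 l.ai (Nat.add mOne 15))) g2 g4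
    (pw2 g4)) (pw2 g2)) (pw2 g)) (Nat.add l.a 1)

/-- Code of the endomorphism with the given images of the generators. -/
def packC (x : (G × G) × G) : Nat :=
  1073741824 + 1099511627776 * (colCode x.1.1 +
      1099511627776 * (colCode x.1.2 + 1099511627776 * colCode x.2))
/-- The possible images of `gc`. -/
def imgC : List G :=
  [1, 3, 5, 7, 9, 11, 13, 15].flatMap fun r => [(0, 0, r), (0, 1, r), (1, 0, r), (1, 1, r)]
/-- The possible images of `(ga, gb)` under automorphisms. -/
def imgA : List (G × G) :=
  [((1, 0), (0, 1)), ((1, 0), (1, 1)), ((0, 1), (1, 0)), ((0, 1), (1, 1)), ((1, 1), (1, 0)),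
    ((1, 1), (0, 1))].flatMap fun (x : (ZMod 2 × ZMod 2) × (ZMod 2 × ZMod 2)) =>
    [((x.1.1, x.1.2, 0), (x.2.1, x.2.2, 0)), ((x.1.1, x.1.2, 8), (x.2.1, x.2.2, 0)),
     ((x.1.1, x.1.2, 0), (x.2.1, x.2.2, 8)), ((x.1.1, x.1.2, 8), (x.2.1, x.2.2, 8))]
/-- The possible images of `(ga, gb)` under automorphisms preserving levels. -/
def imgS : List (G × G) := imgA.take 8
/-- The possible images of `(ga, gb)` under automorphisms of the smaller kind. -/
def imgQ : List (G × G) := imgA.take 4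
/-- The automorphisms with the given images of `(ga, gb)`. -/
def autL (l : List (G × G)) : List AE := (l.product imgC).map fun x => mkAE (packC x)

/-- The levels from the second on. -/
def runTop (nq : Bool) (L : List AE) : Node → Nat :=
  stepS (L.map (mkCE 4 12)) 4 TE.p4 (stepS (L.map (mkCE 2 14)) 2 TE.p2
    (stepS (L.map (mkCE 1048576 1048576)) 32 TE.pa (step5 (L.map (mkCE 1024 1024)) nq fin6)))
/-- The trivial subgroup. -/
def root (L T : List AE) : Node :=
  Node.mk mOne (List.cons lOne List.nil) List.nil (T.map mkTE) (L.map mkGE)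
/-- The enumeration restricted to the given generators of the first level. -/
def run (nq : Bool) (L T L₀ : List AE) : Nat :=
  stepS (L₀.map (mkCE 8 8)) 8 TE.p8 (runTop nq L) (root L T)

/-! ### Elementary properties of the combinators -/

theorem andC_iff {x y : Bool} : andC x y = true ↔ x = true ∧ y = true := by
  cases x <;> cases y <;> simp [andC]

theorem iteC_eq {α : Type} (x : Bool) (y z : α) : iteC x y z = if x = true then y else z := by
  cases x <;> rfl

theorem allC_cons {α : Type} (p : α → Bool) (a : α) (l : List α) :
    allC p (a :: l) = andC (p a) (allC p l) := rfl

theorem allC_iff {α : Type} (p : α → Bool) (l : List α) :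
    allC p l = true ↔ ∀ a ∈ l, p a = true := by
  induction l with
  | nil => simp [allC]
  | cons a l ih => simp [allC_cons, andC_iff, ih]

theorem sumL_eq {α : Type} (f : α → ℕ) (l : List α) : sumL f l = (l.map f).sum := by
  induction l with
  | nil => rfl
  | cons a l ih =>
    rw [List.map_cons, List.sum_cons, ← ih]
    rfl

theorem beq_iff {x y : ℕ} : Nat.beq x y = true ↔ x = y := Nat.beq_eq ▸ Iff.rfl

theorem softE_iff {e w : ℕ} : softE e w = true ↔ e = 0 ∨ e = w := by
  unfold softE
  cases h : Nat.beq e w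
  · have : e ≠ w := fun h' => by simp [h'] at h
    simp [this]
  · have := Nat.eq_of_beq_eq_true h
    simp [this]

/-! ### Arrays -/

theorem getC_def (arr j : ℕ) : getC arr j = (arr >>> (160 * j)) % 2 ^ 160 := rfl
theorem setC_def (arr j w : ℕ) : setC arr j w = arr ||| (w <<< (160 * j)) := rfl

theorem getC_zero (j : ℕ) : getC 0 j = 0 := by
  rw [getC_def]
  simp

theorem testBit_getC (arr j i : ℕ) :
    (getC arr j).testBit i = (decide (i < 160) && arr.testBit (160 * j + i)) := by
  rw [getC_def, Nat.testBit_mod_two_pow, Nat.testBit_shiftRight]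

theorem testBit_of_lt {w i : ℕ} (hw : w < 2 ^ 160) (hi : 160 ≤ i) : w.testBit i = false :=
  Nat.testBit_lt_two_pow (hw.trans_le (Nat.pow_le_pow_right (by norm_num) hi))

theorem getC_setC_self {arr j w : ℕ} (hw : w < 2 ^ 160) (h : getC arr j = 0 ∨ getC arr j = w) :
    getC (setC arr j w) j = w := by
  apply Nat.eq_of_testBit_eq
  intro i
  rw [testBit_getC, setC_def, Nat.testBit_or, Nat.testBit_shiftLeft]
  by_cases hi : i < 160
  · have := testBit_getC arr j i
    rw [decide_eq_true hi, Bool.true_and] at this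
    rw [← this, decide_eq_true hi]
    rcases h with h | h <;> simp [h]
  · simp [hi, testBit_of_lt hw (not_lt.mp hi)]

theorem getC_setC_of_ne {arr j j' w : ℕ} (hw : w < 2 ^ 160) (h : j' ≠ j) :
    getC (setC arr j w) j' = getC arr j' := by
  apply Nat.eq_of_testBit_eq
  intro i
  rw [testBit_getC, testBit_getC, setC_def, Nat.testBit_or, Nat.testBit_shiftLeft]
  by_cases hi : i < 160
  · have : (decide (160 * j' + i ≥ 160 * j) && w.testBit (160 * j' + i - 160 * j)) = false := by
      by_cases hj : 160 * j' + i ≥ 160 * j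
      · rw [testBit_of_lt hw (by omega), Bool.and_false]
      · simp [hj]
    rw [this, Bool.or_false]
  · simp [hi]

/-- An array contains the elements of `M`, indexed by the values of `pos`. -/
def ArrOK (pos : Hol G → G) (arr : ℕ) (M : Set (Hol G)) : Prop :=
  ∀ x : G, (∃ h ∈ M, pos h = x ∧ getC arr (slot x) = enc h) ∨
    (getC arr (slot x) = 0 ∧ ∀ h ∈ M, pos h ≠ x)

theorem arrOK_zero (pos : Hol G → G) : ArrOK pos 0 ∅ := fun _ => Or.inr ⟨getC_zero _, by simp⟩

theorem ArrOK.insert {pos : Hol G → G} {arr : ℕ} {M : Set (Hol G)} (hM : ArrOK pos arr M)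
    {h : Hol G} (hinj : ∀ g ∈ M, pos g = pos h → g = h) :
    ArrOK pos (setC arr (slot (pos h)) (enc h)) (insert h M) := by
  intro x
  by_cases hx : x = pos h
  · subst hx
    refine Or.inl ⟨h, Set.mem_insert _ _, rfl, getC_setC_self (enc_lt h) ?_⟩
    rcases hM (pos h) with ⟨g, hg, hgp, hge⟩ | ⟨h0, -⟩
    · rw [hge, hinj g hg hgp]
      exact Or.inr rfl
    · exact Or.inl h0
  · rw [getC_setC_of_ne (enc_lt h) (fun e => hx (slot_injective e))]
    rcases hM x with ⟨g, hg, hgp, hge⟩ | ⟨h0, h1⟩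
    · exact Or.inl ⟨g, Set.mem_insert_of_mem _ hg, hgp, hge⟩
    · refine Or.inr ⟨h0, ?_⟩
      rintro g (rfl | hg)
      · exact Ne.symm hx
      · exact h1 g hg

theorem ArrOK.get {pos : Hol G → G} {arr : ℕ} {M : Set (Hol G)} (hM : ArrOK pos arr M)
    (hinj : ∀ g ∈ M, ∀ h ∈ M, pos g = pos h → g = h) {h : Hol G} (hh : h ∈ M) :
    getC arr (slot (pos h)) = enc h := by
  rcases hM (pos h) with ⟨g, hg, hgp, hge⟩ | ⟨-, h1⟩
  · rw [hge, hinj g hg h hh hgp]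
  · exact absurd rfl (h1 h hh)

theorem membC_enc {arr : ℕ} {M : Set (Hol G)} (hM : ArrOK Prod.fst arr M)
    (hinj : ∀ g ∈ M, ∀ h ∈ M, g.1 = h.1 → g = h) (w : Hol G) :
    membC arr (enc w) = true ↔ w ∈ M := by
  rw [membC, idxC_enc, beq_iff]
  constructor
  · intro e
    rcases hM w.1 with ⟨g, hg, -, hge⟩ | ⟨h0, -⟩
    · rw [hge] at e
      rwa [← enc_injective e]
    · exact absurd (e.symm.trans h0) (enc_pos w)
  · intro hw
    exact hM.get hinj hw

theorem softC_enc {arr : ℕ} {M : Set (Hol G)} (hM : ArrOK Prod.fst arr M) {w : Hol G}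
    (hinj : ∀ g ∈ M, g.1 = w.1 → g = w) : softC arr (enc w) = true := by
  rw [softC, idxC_enc, softE_iff]
  rcases hM w.1 with ⟨g, hg, hgp, hge⟩ | ⟨h0, -⟩
  · rw [hge, hinj g hg hgp]
    exact Or.inr rfl
  · exact Or.inl h0

theorem mapMul_enc (h : Hol G) (l tl : List (Hol G)) :
    mapMul (enc h) (l.map encL) (tl.map encL) = (l.map (· * h) ++ tl).map encL := by
  induction l with
  | nil => rfl
  | cons x l ih =>
    have : mapMul (enc h) ((x :: l).map encL) (tl.map encL) =
      mulL (mulP (encL x) (enc h)) :: mapMul (enc h) (l.map encL) (tl.map encL) := rfl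
    rw [this, ih, mulP_enc, mulL_enc]
    rfl

theorem fillC_enc {M N : Set (Hol G)} (hN : ∀ g ∈ N, ∀ h ∈ N, g.1 = h.1 → g = h) (hMN : M ⊆ N)
    (h : Hol G) (l : List (Hol G)) (hl : ∀ x ∈ l, x * h ∈ N) {arr : ℕ}
    (harr : ArrOK Prod.fst arr M) :
    ArrOK Prod.fst (fillC (enc h) (l.map encL) arr) (M ∪ {y | ∃ x ∈ l, y = x * h}) := by
  induction l generalizing M arr with
  | nil => simpa using! harr
  | cons x l ih =>
    have e : fillC (enc h) ((x :: l).map encL) arr = fillC (enc h) (l.map encL)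
      (setC arr (idxC (mul3 (encL x) (enc h) rOne)) (mul3 (encL x) (enc h) rOne)) := rfl
    have hx := hl x List.mem_cons_self
    have := ih (M := insert (x * h) M) (Set.insert_subset hx hMN)
      (fun y hy => hl y (List.mem_cons_of_mem _ hy))
      (harr.insert (fun g hg hgp => hN g (hMN hg) _ hx hgp))
    rw [e, mul3_one_enc, idxC_enc]
    convert this using 1
    ext y
    simp only [Set.mem_union, Set.mem_ofPred_eq, List.mem_cons, exists_eq_or_imp, Set.mem_insert_iff]
    tauto

theorem tabC_enc (l : List (Hol G)) (hl : ∀ x ∈ l, ∀ y ∈ l, x.1 + x.2 gc = y.1 + y.2 gc → x = y) :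
    ArrOK (fun x => x.1 + x.2 gc) (tabC (l.map encL)) {x | x ∈ l} := by
  induction l with
  | nil => simpa using! arrOK_zero (fun x => x.1 + x.2 gc)
  | cons x l ih =>
    have e : tabC ((x :: l).map encL) = setC (tabC (l.map encL))
      (idxC (mul3 (encL x) (nat_lit 1329227997022855913342108840860057601) rOne))
      (mul3 (encL x) mOne rOne) := rfl
    have h1 : (nat_lit 1329227997022855913342108840860057601) = enc (gc, 0) := by
      rw [enc_translate]
      have : enc (0, 0) = mOne := mOne_enc.symm
      rw [this]
      rfl
    rw [e, h1, mul3_one_enc, mOne_enc, mul3_one_enc, mul_one, idxC_enc,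
      show (x * ((gc, 0) : Hol G)).1 = x.1 + x.2 gc from rfl]
    have := (ih fun y hy z hz => hl y (List.mem_cons_of_mem _ hy) z
      (List.mem_cons_of_mem _ hz)).insert (h := x) (fun g hg hgp => hl g
        (List.mem_cons_of_mem _ hg) x List.mem_cons_self hgp)
    convert this using 1
    ext y
    simp

/-! ### The comparison and filter loops -/

theorem chkT_cons (arr v : ℕ) (pos : TE → ℕ) (cont : List TE → ℕ) (t : TE) (T acc : List TE) :
    chkT arr v pos cont (t :: T) acc =
      if getC arr (pos t) = 0 then chkT arr v pos cont T (t :: acc)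
      else if mul3 t.s (getC arr (pos t)) t.si = v then chkT arr v pos cont T (t :: acc)
      else if v ≤ mul3 t.s (getC arr (pos t)) t.si then chkT arr v pos cont T acc else 0 := by
  have : chkT arr v pos cont (t :: T) acc = iteC (Nat.beq (getC arr (pos t)) (nat_lit 0))
      (chkT arr v pos cont T (t :: acc)) (iteC (Nat.beq (mul3 t.s (getC arr (pos t)) t.si) v)
        (chkT arr v pos cont T (t :: acc)) (iteC (Nat.ble v (mul3 t.s (getC arr (pos t)) t.si))
        (chkT arr v pos cont T acc) (nat_lit 0))) := rfl
  rw [this, iteC_eq, iteC_eq, iteC_eq]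
  simp only [Nat.beq_eq, Nat.ble_eq]

theorem chkT_spec {A : Type*} (te : A → TE) (arr v : ℕ) (pos : TE → ℕ) (cont : List TE → ℕ)
    (T acc : List A) :
    (chkT arr v pos cont (T.map te) (acc.map te) = 0 ∧ ∃ σ ∈ T, getC arr (pos (te σ)) ≠ 0 ∧
      mul3 (te σ).s (getC arr (pos (te σ))) (te σ).si < v) ∨
    ∃ T' : List A, chkT arr v pos cont (T.map te) (acc.map te) = cont (T'.map te) ∧
      (∀ σ ∈ T', σ ∈ acc ∨ σ ∈ T) ∧ (∀ σ ∈ acc, σ ∈ T') ∧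
      (∀ σ ∈ T', σ ∈ acc ∨ getC arr (pos (te σ)) = 0 ∨
        mul3 (te σ).s (getC arr (pos (te σ))) (te σ).si = v) ∧
      (∀ σ ∈ T, σ ∈ T' ∨ getC arr (pos (te σ)) ≠ 0 ∧
        v < mul3 (te σ).s (getC arr (pos (te σ))) (te σ).si) := by
  induction T generalizing acc with
  | nil =>
    exact Or.inr ⟨acc, rfl, fun σ h => Or.inl h, fun σ h => h, fun σ h => Or.inl h, by simp⟩
  | cons t T ih =>
    rw [List.map_cons, chkT_cons]
    have keep : (getC arr (pos (te t)) = 0 ∨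
        mul3 (te t).s (getC arr (pos (te t))) (te t).si = v) →
        (chkT arr v pos cont (T.map te) (te t :: acc.map te) = 0 ∧ ∃ σ ∈ t :: T,
          getC arr (pos (te σ)) ≠ 0 ∧ mul3 (te σ).s (getC arr (pos (te σ))) (te σ).si < v) ∨
        ∃ T' : List A, chkT arr v pos cont (T.map te) (te t :: acc.map te) = cont (T'.map te) ∧
          (∀ σ ∈ T', σ ∈ acc ∨ σ ∈ t :: T) ∧ (∀ σ ∈ acc, σ ∈ T') ∧
          (∀ σ ∈ T', σ ∈ acc ∨ getC arr (pos (te σ)) = 0 ∨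
            mul3 (te σ).s (getC arr (pos (te σ))) (te σ).si = v) ∧
          (∀ σ ∈ t :: T, σ ∈ T' ∨ getC arr (pos (te σ)) ≠ 0 ∧
            v < mul3 (te σ).s (getC arr (pos (te σ))) (te σ).si) := by
      intro ht
      rcases ih (t :: acc) with ⟨h0, σ, hσ, h1⟩ | ⟨T', h0, h1, h2, h3, h4⟩
      · exact Or.inl ⟨h0, σ, List.mem_cons_of_mem _ hσ, h1⟩
      · refine Or.inr ⟨T', h0, ?_, ?_, ?_, ?_⟩
        · intro σ hσ
          have := h1 σ hσ
          simp only [List.mem_cons] at this ⊢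
          tauto
        · exact fun σ hσ => h2 σ (List.mem_cons_of_mem _ hσ)
        · intro σ hσ
          rcases h3 σ hσ with h | h
          · rcases List.mem_cons.mp h with rfl | h
            · exact Or.inr ht
            · exact Or.inl h
          · exact Or.inr h
        · intro σ hσ
          rcases List.mem_cons.mp hσ with rfl | h
          · exact Or.inl (h2 σ List.mem_cons_self)
          · exact h4 σ h
    split_ifs with c1 c2 c3
    · exact keep (Or.inl c1)
    · exact keep (Or.inr c2)
    · rcases ih acc with ⟨h0, σ, hσ, h1⟩ | ⟨T', h0, h1, h2, h3, h4⟩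
      · exact Or.inl ⟨h0, σ, List.mem_cons_of_mem _ hσ, h1⟩
      · refine Or.inr ⟨T', h0, ?_, h2, h3, ?_⟩
        · intro σ hσ
          have := h1 σ hσ
          simp only [List.mem_cons]
          tauto
        · intro σ hσ
          rcases List.mem_cons.mp hσ with rfl | h
          · exact Or.inr ⟨c1, lt_of_le_of_ne c3 (Ne.symm c2)⟩
          · exact h4 σ h
    · exact Or.inl ⟨rfl, t, List.mem_cons_self, c1, not_le.mp c3⟩

theorem filtG_eq (p : GE → Bool) (cont : List GE → ℕ) (Γ acc : List GE) :
    filtG p cont Γ acc = if (Γ.filter p).reverse ++ acc = [] then 0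
      else cont ((Γ.filter p).reverse ++ acc) := by
  induction Γ generalizing acc with
  | nil => cases acc <;> rfl
  | cons g Γ ih =>
    have : filtG p cont (g :: Γ) acc = iteC (p g) (filtG p cont Γ (g :: acc)) (filtG p cont Γ acc) :=
      rfl
    rw [this, iteC_eq, ih, ih]
    by_cases h : p g = true
    · simp [h]
    · simp [h]

theorem filtG_spec {A : Type*} (ge : A → GE) (p : GE → Bool) (cont : List GE → ℕ) (Γ : List A)
    (hΓ : Γ.Nodup) :
    (filtG p cont (Γ.map ge) [] = 0 ∧ ∀ g ∈ Γ, p (ge g) = false) ∨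
    ∃ Γ' : List A, filtG p cont (Γ.map ge) [] = cont (Γ'.map ge) ∧ Γ'.Nodup ∧
      ∀ g, g ∈ Γ' ↔ g ∈ Γ ∧ p (ge g) = true := by
  rw [filtG_eq, List.append_nil, List.filter_map, ← List.map_reverse]
  split_ifs with h
  · left
    refine ⟨rfl, fun g hg => ?_⟩
    simp only [List.map_eq_nil_iff, List.reverse_eq_nil_iff, List.filter_eq_nil_iff] at h
    simpa using h g hg
  · right
    refine ⟨_, rfl, List.nodup_reverse.mpr (hΓ.filter _), fun g => ?_⟩
    simp

/-- The number of elements of a list counted by `countG`. -/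
theorem countG_eq {A : Type*} (ge : A → GE) (P : List CE) (Γ : List A) :
    countG P (Γ.map ge) = (Γ.filter fun g => minG P (ge g).m).length := by
  induction Γ with
  | nil => rfl
  | cons g Γ ih =>
    have : countG P ((g :: Γ).map ge) = iteC (minG P (ge g).m) (Nat.succ (countG P (Γ.map ge)))
      (countG P (Γ.map ge)) := rfl
    rw [this, iteC_eq, ih]
    by_cases h : minG P (ge g).m = true
    · simp [h]
    · simp [h]

theorem preT_eq (tab : ℕ) (T : List TE) : preT tab T =
    T.map fun t => CE.mk (mulL (mulP t.s (getC tab t.pc))) (nat_lit 0) t.si := by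
  induction T with
  | nil => rfl
  | cons t T ih =>
    rw [List.map_cons, ← ih]
    rfl

/-! ### Levels -/

/-- The level of an element with respect to the chain of subgroups
`0 < ⟨8c⟩ < ⟨4c⟩ < ⟨2c⟩ < ⟨2c, a⟩ < ⟨2c, a, b⟩ < G`. -/
def lev (x : G) : ℕ :=
  if x.2.2.val % 2 = 1 then 6 else if x.2.1 = 1 then 5 else if x.1 = 1 then 4 else
  if x.2.2 = 0 then 0 else if x.2.2 = 8 then 1 else if x.2.2.val % 4 = 0 then 2 else 3

theorem lev_le (x : G) : lev x ≤ 6 := by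
  revert x
  decide +kernel

theorem lev_neg (x : G) : lev (-x) = lev x := by
  revert x
  decide +kernel

theorem lev_eq_zero {x : G} : lev x = 0 ↔ x = 0 := by
  revert x
  decide +kernel

theorem lev_add_le (x y : G) : lev (x + y) ≤ max (lev x) (lev y) := by
  revert x y
  decide +kernel

theorem lev_add_of_lt {x y : G} (h : lev x < lev y) : lev (x + y) = lev y := by
  revert x y
  decide +kernel

theorem lev_sub_lt {x y : G} (h : lev x = lev y) (h0 : lev x ≠ 0) : lev (x - y) < lev x := by
  revert x y
  decide +kernel

/-- The automorphisms preserving levels. -/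
def autS : AddSubgroup (AddAut G) where
  carrier := {α | ∀ x, lev (α x) = lev x}
  add_mem' {α β} hα hβ x := (hα (β x)).trans (hβ x)
  zero_mem' _ := rfl
  neg_mem' {α} hα x := by
    have : α ((-α) x) = x := AddEquiv.apply_symm_apply α x
    rw [← hα, this]

theorem mem_autS {α : AddAut G} : α ∈ autS ↔ ∀ x, lev (α x) = lev x := Iff.rfl

theorem apply_neg_apply (α : AddAut G) (x : G) : α ((-α) x) = x := AddEquiv.apply_symm_apply α x
theorem neg_apply_apply (α : AddAut G) (x : G) : (-α) (α x) = x := AddEquiv.symm_apply_apply α x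

theorem autS_first {β : AddAut G} (hβ : β ∈ autS) (p q : ZMod 2) (r : ZMod 16) :
    (β (p, q, 2 * r)).1 = p + q * (β gb).1 ∧ (β (p, q, 2 * r)).2.1 = q := by
  have hfact : ∀ x y z : G, lev x = 4 → lev y = 5 → lev z = 6 → ∀ (p q : ZMod 2) (r : ZMod 16),
      (p.val • x + (q.val • y + (2 * r).val • z)).1 = p + q * y.1 ∧
      (p.val • x + (q.val • y + (2 * r).val • z)).2.1 = q := by
    intro x y z hx hy hz p q r
    have h1 : x.1 = 1 ∧ x.2.1 = 0 := by revert x; decide +kernel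
    have h2 : y.2.1 = 1 := by revert y; decide +kernel
    have h3 : ∀ (r : ZMod 16) (t : ZMod 2), (2 * r).val • t = 0 := by decide +kernel
    have h4 : ∀ p t : ZMod 2, p.val • t = p * t := by decide +kernel
    simp only [Prod.fst_add, Prod.snd_add, Prod.smul_fst, Prod.smul_snd, h1, h2, h3, h4]
    simp
  have := hfact _ _ _ ((hβ ga).trans rfl) ((hβ gb).trans rfl) ((hβ gc).trans rfl) p q r
  have e := map_eq_combination β.toAddMonoidHom (p, q, 2 * r)
  have e' : β (p, q, 2 * r) = β.toAddMonoidHom (p, q, 2 * r) := rfl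
  rw [e', e]
  exact this

theorem autS_gb {β : AddAut G} (hβ : β ∈ autS) : ∃ r : ZMod 16, β gb = ((β gb).1, 1, 2 * r) := by
  have : ∀ y : G, lev y = 5 → ∃ r : ZMod 16, y = (y.1, 1, 2 * r) := by decide +kernel
  exact this _ ((hβ gb).trans rfl)

theorem add_gb_fst {α β : AddAut G} (hα : α ∈ autS) (hβ : β ∈ autS) :
    ((α + β) gb).1 = (α gb).1 + (β gb).1 := by
  obtain ⟨r, hr⟩ := autS_gb hβ
  have h1 : (α + β) gb = α (β gb) := rfl
  rw [h1, hr, (autS_first hα _ _ _).1]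
  simp [add_comm]

/-- The level-preserving automorphisms acting trivially on the involutions modulo `8c`. -/
def autQ : AddSubgroup (AddAut G) where
  carrier := {α | α ∈ autS ∧ (α gb).1 = 0}
  add_mem' {α β} hα hβ := by
    refine ⟨add_mem hα.1 hβ.1, ?_⟩
    rw [add_gb_fst hα.1 hβ.1, hα.2, hβ.2, add_zero]
  zero_mem' := ⟨zero_mem _, rfl⟩
  neg_mem' {α} hα := by
    refine ⟨neg_mem hα.1, ?_⟩
    have := add_gb_fst hα.1 (neg_mem hα.1)
    rw [add_neg_cancel, hα.2, zero_add] at this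
    exact this.symm

theorem mem_autQ {α : AddAut G} : α ∈ autQ ↔ α ∈ autS ∧ (α gb).1 = 0 := Iff.rfl

/-! ### Subgroups of the holomorph -/

theorem mul_fst (g h : Hol G) : (g * h).1 = g.1 + g.2 h.1 := rfl
theorem mul_snd (g h : Hol G) : (g * h).2 = g.2 + h.2 := rfl
theorem inv_fst (g : Hol G) : g⁻¹.1 = -((-g.2) g.1) := rfl
theorem inv_snd (g : Hol G) : g⁻¹.2 = -g.2 := rfl

/-- The elements of the holomorph with linear part in a given group. -/
def holOf (A : AddSubgroup (AddAut G)) : Subgroup (Hol G) where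
  carrier := {h | h.2 ∈ A}
  mul_mem' hx hy := A.add_mem hx hy
  one_mem' := A.zero_mem
  inv_mem' hx := A.neg_mem hx

/-- Subgroups whose elements are in bijection with the elements of `G` of level at most `i`. -/
structure IsLev (i : ℕ) (K : Subgroup (Hol G)) : Prop where
  mem : K ≤ holOf autS
  le : ∀ h ∈ K, lev h.1 ≤ i
  cover : ∀ x, lev x ≤ i → ∃ h ∈ K, h.1 = x
  inj : ∀ g ∈ K, ∀ h ∈ K, g.1 = h.1 → g = h

theorem conj_fst (h g : Hol G) :
    (h * g * h⁻¹).1 = (h.1 - (h.2 + g.2 + -h.2) h.1) + h.2 g.1 := by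
  have : (h * g * h⁻¹).1 = h.1 + h.2 g.1 + h.2 (g.2 (-((-h.2) h.1))) := rfl
  rw [this, map_neg, map_neg]
  have : (h.2 + g.2 + -h.2) h.1 = h.2 (g.2 ((-h.2) h.1)) := rfl
  rw [this]
  abel

theorem lev_conj_le {h g : Hol G} {i : ℕ} (hh : h.2 ∈ autS) (hg : g.2 ∈ autS) (hl : lev h.1 = i + 1)
    (hgl : lev g.1 ≤ i) : lev (h * g * h⁻¹).1 ≤ i := by
  rw [conj_fst]
  have h1 : (h.2 + g.2 + -h.2) ∈ autS := add_mem (add_mem hh hg) (neg_mem hh)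
  have h2 := lev_sub_lt (h1 h.1).symm (by omega)
  have h3 := hh g.1
  exact (lev_add_le _ _).trans (max_le (by omega) (by omega))

theorem lev_sq_le {h : Hol G} {i : ℕ} (hh : h.2 ∈ autS) (hl : lev h.1 = i + 1) :
    lev (h * h).1 ≤ i := by
  have h1 : lev (-(h.2 h.1)) = lev h.1 := (lev_neg _).trans (hh _)
  have h2 := lev_sub_lt h1.symm (by omega)
  rw [sub_neg_eq_add] at h2
  rw [mul_fst]
  omega

section Extension

variable {i : ℕ} {K : Subgroup (Hol G)} {h : Hol G}

theorem inv_conj_mem (hsq : h * h ∈ K) (hn : ∀ g ∈ K, h * g * h⁻¹ ∈ K) {g : Hol G} (hg : g ∈ K) :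
    h⁻¹ * g * h ∈ K := by
  have : h⁻¹ * g * h = (h * h)⁻¹ * (h * g * h⁻¹) * (h * h) := by group
  rw [this]
  exact mul_mem (mul_mem (inv_mem hsq) (hn g hg)) hsq

/-- The union of a subgroup with one coset. -/
def extend (K : Subgroup (Hol G)) (h : Hol G) (hsq : h * h ∈ K)
    (hn : ∀ g ∈ K, h * g * h⁻¹ ∈ K) : Subgroup (Hol G) where
  carrier := {x | x ∈ K ∨ ∃ y ∈ K, x = y * h}
  one_mem' := Or.inl (one_mem K)
  mul_mem' := by
    rintro x y (hx | ⟨x, hx, rfl⟩) (hy | ⟨y, hy, rfl⟩)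
    · exact Or.inl (mul_mem hx hy)
    · exact Or.inr ⟨x * y, mul_mem hx hy, by group⟩
    · exact Or.inr ⟨x * (h * y * h⁻¹), mul_mem hx (hn y hy), by group⟩
    · refine Or.inl ?_
      have : x * h * (y * h) = x * (h * y * h⁻¹) * (h * h) := by group
      rw [this]
      exact mul_mem (mul_mem hx (hn y hy)) hsq
  inv_mem' := by
    rintro x (hx | ⟨x, hx, rfl⟩)
    · exact Or.inl (inv_mem hx)
    · refine Or.inr ⟨(h * h)⁻¹ * (h * x⁻¹ * h⁻¹), mul_mem (inv_mem hsq) (hn _ (inv_mem hx)), ?_⟩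
      group

theorem mem_closure_insert {l : List (Hol G)} (hl : Subgroup.closure {x | x ∈ l} = K)
    (hsq : h * h ∈ K) (hn : ∀ g ∈ l, h * g * h⁻¹ ∈ K) (x : Hol G) :
    x ∈ Subgroup.closure {x | x ∈ h :: l} ↔ x ∈ K ∨ ∃ y ∈ K, x = y * h := by
  have hn' : ∀ g ∈ K, h * g * h⁻¹ ∈ K := by
    intro g hg
    have : K ≤ K.comap (MulAut.conj h).toMonoidHom := by
      rw [← hl, Subgroup.closure_le]
      intro y hy
      rw [hl]
      exact hn y hy
    exact this hg
  have hle : K ≤ Subgroup.closure {x | x ∈ h :: l} := by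
    rw [← hl]
    exact Subgroup.closure_mono fun y hy => List.mem_cons_of_mem _ hy
  have hh : h ∈ Subgroup.closure {x | x ∈ h :: l} := Subgroup.subset_closure List.mem_cons_self
  constructor
  · intro hx
    have : Subgroup.closure {x | x ∈ h :: l} ≤ extend K h hsq hn' := by
      rw [Subgroup.closure_le]
      intro y hy
      rcases List.mem_cons.mp hy with rfl | hy
      · exact Or.inr ⟨1, one_mem K, (one_mul _).symm⟩
      · exact Or.inl (hl ▸ Subgroup.subset_closure hy)
    exact this hx
  · rintro (hx | ⟨y, hy, rfl⟩)
    · exact hle hx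
    · exact mul_mem (hle hy) hh

theorem IsLev.coset_cover (hK : IsLev i K) (hh : h.2 ∈ autS) (hlev : lev h.1 = i + 1)
    (hn : ∀ g ∈ K, h * g * h⁻¹ ∈ K) {x : G} (hx : lev x = i + 1) : ∃ y ∈ K, (y * h).1 = x := by
  have h1 : lev ((-h.2) (x - h.1)) ≤ i := by
    have h2 : (-h.2) ∈ autS := neg_mem hh
    rw [h2]
    have := lev_sub_lt (hx.trans hlev.symm) (by omega)
    omega
  obtain ⟨y, hy, hyx⟩ := hK.cover _ h1
  refine ⟨h * y * h⁻¹, hn y hy, ?_⟩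
  rw [inv_mul_cancel_right, mul_fst, hyx, apply_neg_apply]
  abel

theorem IsLev.coset_inj (hK : IsLev i K) (hsq : h * h ∈ K) (hn : ∀ g ∈ K, h * g * h⁻¹ ∈ K)
    {x y : Hol G} (hx : x ∈ K) (hy : y ∈ K) (hxy : (x * h).1 = (y * h).1) : x = y := by
  have key : ∀ z, z * h = h * (h⁻¹ * z * h) := fun z => by group
  rw [key x, key y, mul_fst, mul_fst] at hxy
  have := hK.inj _ (inv_conj_mem hsq hn hx) _ (inv_conj_mem hsq hn hy)
    (h.2.injective (add_left_cancel hxy))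
  simpa using this

theorem IsLev.closure_insert (hK : IsLev i K) {l : List (Hol G)}
    (hl : Subgroup.closure {x | x ∈ l} = K) (hh : h.2 ∈ autS) (hlev : lev h.1 = i + 1)
    (hsq : h * h ∈ K) (hn : ∀ g ∈ l, h * g * h⁻¹ ∈ K) :
    IsLev (i + 1) (Subgroup.closure {x | x ∈ h :: l}) := by
  have hn' : ∀ g ∈ K, h * g * h⁻¹ ∈ K := by
    intro g hg
    have : K ≤ K.comap (MulAut.conj h).toMonoidHom := by
      rw [← hl, Subgroup.closure_le]
      intro y hy
      rw [hl]
      exact hn y hy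
    exact this hg
  have hc : ∀ y ∈ K, lev (y * h).1 = i + 1 := by
    intro y hy
    rw [mul_fst]
    have h1 := hK.le y hy
    have h2 : lev (y.2 h.1) = i + 1 := (hK.mem hy h.1).trans hlev
    rw [lev_add_of_lt (by omega), h2]
  constructor
  · intro x hx
    rcases (mem_closure_insert hl hsq hn x).mp hx with hx | ⟨y, hy, rfl⟩
    · exact hK.mem hx
    · exact mul_mem (hK.mem hy) hh
  · intro x hx
    rcases (mem_closure_insert hl hsq hn x).mp hx with hx | ⟨y, hy, rfl⟩
    · exact (hK.le x hx).trans (Nat.le_succ i)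
    · exact (hc y hy).le
  · intro x hx
    simp only [mem_closure_insert hl hsq hn]
    rcases Nat.lt_or_ge i (lev x) with h1 | h1
    · obtain ⟨y, hy, hyx⟩ := hK.coset_cover hh hlev hn' (x := x) (by omega)
      exact ⟨y * h, Or.inr ⟨y, hy, rfl⟩, hyx⟩
    · obtain ⟨y, hy, hyx⟩ := hK.cover x h1
      exact ⟨y, Or.inl hy, hyx⟩
  · intro x hx y hy hxy
    rw [mem_closure_insert hl hsq hn] at hx hy
    rcases hx with hx | ⟨x, hx, rfl⟩ <;> rcases hy with hy | ⟨y, hy, rfl⟩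
    · exact hK.inj x hx y hy hxy
    · have := hc y hy
      have := hK.le x hx
      rw [hxy] at this
      omega
    · have := hc x hx
      have := hK.le y hy
      rw [← hxy] at this
      omega
    · rw [hK.coset_inj hsq hn' hx hy hxy]

theorem IsLev.mem_of_le (hK : IsLev i K) {H : Subgroup (Hol G)} (hKH : K ≤ H)
    (hH : ∀ g ∈ H, ∀ h ∈ H, g.1 = h.1 → g = h) {x : Hol G} (hx : x ∈ H) (hxl : lev x.1 ≤ i) :
    x ∈ K := by
  obtain ⟨y, hy, hyx⟩ := hK.cover x.1 hxl
  rwa [← hH y (hKH hy) x hx hyx]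

end Extension

/-! ### The automorphisms of `G` -/

theorem forall_of_all {α : Type*} {p : α → Prop} [DecidablePred p] {l : List α}
    (h : l.all (fun x => decide (p x)) = true) : ∀ x ∈ l, p x := by
  simpa using h

/-- The elements of order at most two. -/
def invol : List G :=
  [(0, 0, 0), (0, 0, 8), (0, 1, 0), (0, 1, 8), (1, 0, 0), (1, 0, 8), (1, 1, 0), (1, 1, 8)]

theorem mem_invol : ∀ x : G, x + x = 0 → x ∈ invol := by decide +kernel

/-- The endomorphism with the given images of the generators. -/
def homOf (A B C : G) (hA : (2 : ℤ) • A = 0) (hB : (2 : ℤ) • B = 0) (hC : (16 : ℤ) • C = 0) :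
    G →+ G :=
  (ZMod.lift 2 ⟨zmultiplesHom G A, hA⟩).coprod
    ((ZMod.lift 2 ⟨zmultiplesHom G B, hB⟩).coprod (ZMod.lift 16 ⟨zmultiplesHom G C, hC⟩))

theorem lift_one {n : ℕ} {f : {f : ℤ →+ G // f n = 0}} : ZMod.lift n f 1 = f.1 1 := by
  have := ZMod.lift_coe n f 1
  rwa [Int.cast_one] at this

theorem exists_hom (A B C : G) (hA : (2 : ℤ) • A = 0) (hB : (2 : ℤ) • B = 0) :
    ∃ f : G →+ G, f ga = A ∧ f gb = B ∧ f gc = C := by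
  have hC : (16 : ℤ) • C = 0 := by
    revert C
    decide +kernel
  refine ⟨homOf A B C hA hB hC, ?_, ?_, ?_⟩
  · simp [homOf, ga, lift_one]
  · simp [homOf, gb, lift_one]
  · simp [homOf, gc, lift_one]

theorem imgA_two : ∀ x ∈ imgA, (2 : ℤ) • x.1 = 0 ∧ (2 : ℤ) • x.2 = 0 := by
  simp only [two_smul]
  exact forall_of_all (by decide +kernel)

theorem imgC_eight : ∀ x ∈ imgC, 8 • x = (0, 0, 8) :=
      forall_of_all (by decide +kernel)

theorem imgA_indep : ∀ x ∈ imgA, ∀ p q : ZMod 2,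
    (p.val • x.1 + (q.val • x.2 + 0) = 0 → p = 0 ∧ q = 0) ∧
      p.val • x.1 + (q.val • x.2 + (0, 0, 8)) ≠ 0 :=
      forall_of_all (by decide +kernel)

theorem exists_nsmul_involution : ∀ y : G, y ≠ 0 → ∃ n < 9, n • y ≠ 0 ∧
    ((n • y).2.2 = 0 ∨ (n • y).2.2 = 8) := by decide +kernel

theorem exists_aut {x : G × G} (hx : x ∈ imgA) {z : G} (hz : z ∈ imgC) :
    ∃ σ : AddAut G, σ ga = x.1 ∧ σ gb = x.2 ∧ σ gc = z := by
  obtain ⟨f, hfa, hfb, hfc⟩ := exists_hom x.1 x.2 z (imgA_two x hx).1 (imgA_two x hx).2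
  have hinj : Function.Injective f := by
    rw [injective_iff_map_eq_zero]
    intro y hy
    by_contra hy0
    obtain ⟨n, -, hn0, hn⟩ := exists_nsmul_involution y hy0
    have h0 : f (n • y) = 0 := by rw [map_nsmul, hy, nsmul_zero]
    generalize n • y = w at hn0 hn h0
    rw [map_eq_combination, hfa, hfb, hfc] at h0
    rcases hn with hn | hn
    · rw [hn, ZMod.val_zero, zero_nsmul] at h0
      obtain ⟨h1, h2⟩ := (imgA_indep x hx _ _).1 h0
      exact hn0 (Prod.ext h1 (Prod.ext h2 hn))
    · rw [hn, show (8 : ZMod 16).val = 8 from rfl, imgC_eight z hz] at h0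
      exact (imgA_indep x hx _ _).2 h0
  exact ⟨AddEquiv.ofBijective f (Finite.injective_iff_bijective.mp hinj), hfa, hfb, hfc⟩

theorem mem_imgC {σ : AddAut G} : σ gc ∈ imgC := by
  have h : ∀ z : G, 8 • z ≠ 0 → z ∈ imgC := by decide +kernel
  refine h _ ?_
  rw [← map_nsmul, ne_eq, map_eq_zero_iff σ σ.injective]
  decide +kernel

theorem map_eight (σ : AddAut G) : σ (0, 0, 8) = (0, 0, 8) := by
  have h : ((0, 0, 8) : G) = 8 • gc := by decide +kernel
  conv_lhs => rw [h]
  rw [map_nsmul, imgC_eight _ mem_imgC]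

theorem mem_imgA {σ : AddAut G} : (σ ga, σ gb) ∈ imgA := by
  have h : ∀ x ∈ invol, ∀ y ∈ invol, (x ≠ 0 ∧ x ≠ (0, 0, 8)) ∧ (y ≠ 0 ∧ y ≠ (0, 0, 8)) ∧
      (x + y ≠ 0 ∧ x + y ≠ (0, 0, 8)) → (x, y) ∈ imgA := by decide +kernel
  have h8 := map_eight σ
  have h0 := map_zero σ
  refine h _ (mem_invol _ ?_) _ (mem_invol _ ?_) ⟨⟨?_, ?_⟩, ⟨?_, ?_⟩, ?_, ?_⟩
  · rw [← map_add, ← map_zero σ]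
    congr 1
  · rw [← map_add, ← map_zero σ]
    congr 1
  all_goals
    rw [ne_eq]
    try rw [← map_add]
    first
    | rw [← h8, σ.injective.eq_iff]
      decide +kernel
    | rw [map_eq_zero_iff σ σ.injective]
      decide +kernel

/-- The images of the generators. -/
def img (σ : AddAut G) : (G × G) × G := ((σ ga, σ gb), σ gc)

theorem img_injective : Function.Injective img := by
  intro σ τ h
  simp only [img, Prod.mk.injEq] at h
  ext1 x
  have h1 := map_eq_combination σ.toAddMonoidHom x
  have h2 := map_eq_combination τ.toAddMonoidHom x
  have e1 : ∀ (σ : AddAut G) (y : G), σ.toAddMonoidHom y = σ y := fun _ _ => rfl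
  simp only [e1] at h1 h2
  rw [h1, h2, h.1.1, h.1.2, h.2]

theorem mem_autS_iff {σ : AddAut G} : σ ∈ autS ↔ (σ ga).1 = 1 ∧ (σ ga).2.1 = 0 := by
  constructor
  · intro h
    have : ∀ x : G, lev x = 4 → x.1 = 1 ∧ x.2.1 = 0 := by decide +kernel
    exact this _ ((h ga).trans rfl)
  · intro h x
    have h1 : ∀ x ∈ imgA, x.1.1 = 1 ∧ x.1.2.1 = 0 → lev x.1 = 4 ∧ x.1.2.2 + x.1.2.2 = 0 ∧
      lev x.2 = 5 ∧ x.2.2.2 + x.2.2.2 = 0 :=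
      forall_of_all (by decide +kernel)
    have h2 : ∀ x ∈ imgC, lev x = 6 :=
      forall_of_all (by decide +kernel)
    obtain ⟨ha, ha', hb, hb'⟩ := h1 _ (mem_imgA (σ := σ)) h
    have hc := h2 _ (mem_imgC (σ := σ))
    have h3 : ∀ x : G, lev x = 4 → x.2.2 + x.2.2 = 0 → ∀ p : ZMod 2, lev (p.val • x) =
      lev (p.val • ga) := by decide +kernel
    have h4 : ∀ x : G, lev x = 5 → x.2.2 + x.2.2 = 0 → ∀ p : ZMod 2, lev (p.val • x) =
      lev (p.val • gb) := by decide +kernel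
    have h5 : ∀ x : G, lev x = 6 → ∀ p : ZMod 16, lev (p.val • x) =
      lev (p.val • gc) := by decide +kernel
    have e := map_eq_combination σ.toAddMonoidHom x
    have e1 : ∀ (y : G), σ.toAddMonoidHom y = σ y := fun _ => rfl
    simp only [e1] at e
    rw [e]
    conv_rhs => rw [eq_combination x]
    have h3 := h3 _ ha ha' x.1
    have h4 := h4 _ hb hb' x.2.1
    have h5 := h5 _ hc x.2.2
    have l4 : ∀ p : ZMod 2, lev (p.val • ga) = 0 ∨ lev (p.val • ga) = 4 := by decide +kernel
    have l5 : ∀ p : ZMod 2, lev (p.val • gb) = 0 ∨ lev (p.val • gb) = 5 := by decide +kernel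
    have l6 : ∀ p : ZMod 16, lev (p.val • gc) ≠ 4 ∧ lev (p.val • gc) ≠ 5 := by decide +kernel
    have key : ∀ u v u' v' : G, lev u = lev u' → lev v = lev v' →
        (lev u ≠ lev v ∨ u = 0 ∨ v = 0) → lev (u + v) = lev (u' + v') := by
      intro u v u' v' hu hv huv
      rcases huv with huv | huv | huv
      · rcases lt_or_gt_of_ne huv with h | h
        · rw [lev_add_of_lt h, lev_add_of_lt (by omega), hv]
        · rw [add_comm, lev_add_of_lt h, add_comm, lev_add_of_lt (by omega), hu]
      · have : u' = 0 := lev_eq_zero.mp (hu ▸ lev_eq_zero.mpr huv)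
        rw [huv, this, zero_add, zero_add, hv]
      · have : v' = 0 := lev_eq_zero.mp (hv ▸ lev_eq_zero.mpr huv)
        rw [huv, this, add_zero, add_zero, hu]
    have hbc : lev (x.2.1.val • σ gb + x.2.2.val • σ gc) =
        lev (x.2.1.val • gb + x.2.2.val • gc) := by
      refine key _ _ _ _ h4 h5 ?_
      rcases l5 x.2.1 with h | h
      · exact Or.inr (Or.inl (lev_eq_zero.mp (h4.trans h)))
      · left
        rw [h4, h5, h]
        exact (l6 _).2.symm
    refine key _ _ _ _ h3 hbc ?_
    rcases l4 x.1 with h | h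
    · exact Or.inr (Or.inl (lev_eq_zero.mp (h3.trans h)))
    · left
      rw [h3, hbc, h]
      revert x
      have : ∀ (p : ZMod 2) (r : ZMod 16), 4 ≠ lev (p.val • gb + r.val • gc) := by decide +kernel
      intros
      exact this _ _

theorem mem_imgS_iff {σ : AddAut G} : (σ ga, σ gb) ∈ imgS ↔ σ ∈ autS := by
  have h : ∀ x ∈ imgA, x ∈ imgS ↔ x.1.1 = 1 ∧ x.1.2.1 = 0 :=
      forall_of_all (by decide +kernel)
  rw [mem_autS_iff, h _ mem_imgA]

theorem mem_imgQ_iff {σ : AddAut G} : (σ ga, σ gb) ∈ imgQ ↔ σ ∈ autQ := by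
  have h : ∀ x ∈ imgA, x ∈ imgQ ↔ (x.1.1 = 1 ∧ x.1.2.1 = 0) ∧ x.2.1 = 0 :=
      forall_of_all (by decide +kernel)
  rw [mem_autQ, mem_autS_iff, h _ mem_imgA]

/-! ### Their codes -/

theorem enc_aut (σ : AddAut G) : enc (0, σ) = packC (img σ) := by
  have e : enc (0, σ) = affEnc 0 σ.toAddMonoidHom := rfl
  rw [e, affEnc_eq, show colCode (0 : G) = 0 from rfl, zero_add]
  rfl

theorem toL_enc (h : Hol G) : toL (enc h) = encL h := by
  rw [toL, lOne_enc, mulP_enc, one_mul, mulL_enc]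

theorem mul2_enc (g h : Hol G) : mul2 (enc g) (enc h) = enc (g * h) := by
  rw [mul2, toL_enc, mul3_one_enc]

theorem pw2_enc (g : Hol G) : pw2 (enc g) = enc (g * g) := mul2_enc g g

/-- The codes of an automorphism and of its inverse. -/
def ae (σ : AddAut G) : AE := AE.mk (enc (0, σ)) (enc (0, σ)⁻¹)

theorem mul2_invC : ∀ x ∈ imgA.product imgC, mul2 (packC x) (invC (packC x)) = mOne := by
  have : allC (fun x => Nat.beq (mul2 (packC x) (invC (packC x))) mOne) (imgA.product imgC) =
    true := by decide +kernel
  rw [allC_iff] at this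
  exact fun x hx => Nat.eq_of_beq_eq_true (this x hx)

theorem mkAE_img (σ : AddAut G) : mkAE (packC (img σ)) = ae σ := by
  have h := mul2_invC (img σ) (List.pair_mem_product.mpr ⟨mem_imgA, mem_imgC⟩)
  rw [mkAE, ae, enc_aut]
  refine congrArg (AE.mk _) ?_
  rw [← enc_aut] at h ⊢
  have hp : ∃ g : Hol G, invC (enc (0, σ)) = enc g :=
    ⟨_, by rw [invC, pw2_enc, pw2_enc, pw2_enc, mul2_enc, mul2_enc]⟩
  obtain ⟨g, hg⟩ := hp
  rw [hg, mul2_enc, mOne_enc] at h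
  rw [hg, eq_inv_of_mul_eq_one_right (enc_injective h)]

theorem exists_map_eq {α β : Type*} (f : α → β) (l : List β) (h : ∀ y ∈ l, ∃ x, f x = y) :
    ∃ l' : List α, l'.map f = l := by
  induction l with
  | nil => exact ⟨[], rfl⟩
  | cons y l ih =>
    obtain ⟨x, hx⟩ := h y List.mem_cons_self
    obtain ⟨l', hl⟩ := ih fun z hz => h z (List.mem_cons_of_mem _ hz)
    exact ⟨x :: l', by rw [List.map_cons, hx, hl]⟩

theorem exists_autList (l : List (G × G)) (hl : ∀ x ∈ l, x ∈ imgA) (hn : l.Nodup) :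
    ∃ L : List (AddAut G), L.map ae = autL l ∧ L.Nodup ∧ ∀ σ, σ ∈ L ↔ (σ ga, σ gb) ∈ l := by
  obtain ⟨L, hL⟩ := exists_map_eq img (l.product imgC) (by
    rintro ⟨x, z⟩ hxz
    obtain ⟨hx, hz⟩ := List.pair_mem_product.mp hxz
    obtain ⟨σ, h1, h2, h3⟩ := exists_aut (hl x hx) hz
    exact ⟨σ, by rw [img, h1, h2, h3]⟩)
  refine ⟨L, ?_, ?_, fun σ => ?_⟩
  · rw [autL, ← hL, List.map_map]
    exact List.map_congr_left fun σ _ => (mkAE_img σ).symm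
  · refine List.Nodup.of_map img (hL ▸ List.Nodup.product hn ?_)
    decide +kernel
  · rw [← List.mem_map_of_injective img_injective, hL, img, List.pair_mem_product]
    exact and_iff_left mem_imgC

/-! ### Regular subgroups and their conjugates -/

theorem isRegular_iff {H : Subgroup (Hol G)} :
    Hol.IsRegular H ↔ (∀ x, ∃ h ∈ H, h.1 = x) ∧ ∀ g ∈ H, ∀ h ∈ H, g.1 = h.1 → g = h := by
  constructor
  · intro hH
    refine ⟨fun x => ?_, fun g hg h hh e => ?_⟩
    · obtain ⟨h, ⟨hh, hx⟩, -⟩ := hH 0 x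
      exact ⟨h, hh, by simpa [Hol.smul] using hx⟩
    · refine (hH 0 g.1).unique ⟨hg, by simp [Hol.smul]⟩ ⟨hh, by simp [Hol.smul, e]⟩
  · rintro ⟨hc, hi⟩ x y
    obtain ⟨u, hu, rfl⟩ := hc x
    obtain ⟨v, hv, rfl⟩ := hc y
    refine ⟨v * u⁻¹, ⟨mul_mem hv (inv_mem hu), ?_⟩, ?_⟩
    · change (v * u⁻¹ * u).1 = v.1
      rw [inv_mul_cancel_right]
    · rintro h ⟨hh, e⟩
      have : h * u = v := hi _ (mul_mem hh hu) _ hv e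
      rw [← this, mul_inv_cancel_right]

/-- The element of a regular subgroup with a given translation part. -/
noncomputable def el (H : Subgroup (Hol G)) (x : G) : Hol G :=
  Classical.epsilon fun h => h ∈ H ∧ h.1 = x

theorem el_spec {H : Subgroup (Hol G)} (hH : Hol.IsRegular H) (x : G) : el H x ∈ H ∧ (el H x).1 = x :=
  Classical.epsilon_spec (p := fun h => h ∈ H ∧ h.1 = x) ((isRegular_iff.1 hH).1 x)

theorem el_mem {H : Subgroup (Hol G)} (hH : Hol.IsRegular H) (x : G) : el H x ∈ H := (el_spec hH x).1

theorem el_fst {H : Subgroup (Hol G)} (hH : Hol.IsRegular H) (x : G) : (el H x).1 = x := (el_spec hH x).2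

theorem el_eq {H : Subgroup (Hol G)} (hH : Hol.IsRegular H) {h : Hol G} (hh : h ∈ H) {x : G} (hx : h.1 = x) : el H x = h :=
  (isRegular_iff.1 hH).2 _ (el_mem hH x) _ hh ((el_fst hH x).trans hx.symm)

/-- The conjugate of a subgroup by an automorphism. -/
def cjH (σ : AddAut G) (H : Subgroup (Hol G)) : Subgroup (Hol G) :=
  H.map (MulAut.conj ((0, σ) : Hol G)).toMonoidHom

theorem mem_cjH {σ : AddAut G} {H : Subgroup (Hol G)} {g : Hol G} :
    g ∈ cjH σ H ↔ ∃ h ∈ H, (0, σ) * h * (0, σ)⁻¹ = g := Iff.rfl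

theorem conj_aut_fst (σ : AddAut G) (h : Hol G) :
    (((0, σ) : Hol G) * h * ((0, σ) : Hol G)⁻¹).1 = σ h.1 := by
  rw [conj_fst]
  simp

theorem conj_aut_snd (σ : AddAut G) (h : Hol G) :
    (((0, σ) : Hol G) * h * ((0, σ) : Hol G)⁻¹).2 = σ + h.2 + -σ := rfl

theorem cjH_zero (H : Subgroup (Hol G)) : cjH 0 H = H := by
  ext g
  rw [mem_cjH]
  have : ((0, 0) : Hol G) = 1 := rfl
  simp [this]

theorem cjH_cjH (σ τ : AddAut G) (H : Subgroup (Hol G)) : cjH σ (cjH τ H) = cjH (σ + τ) H := by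
  unfold cjH
  rw [Subgroup.map_map]
  congr 1
  have : ((0, σ + τ) : Hol G) = (0, σ) * (0, τ) := Prod.ext (by simp [mul_fst]) rfl
  ext1 x
  rw [this]
  simp [mul_assoc]

theorem cjH_neg_cjH (σ : AddAut G) (H : Subgroup (Hol G)) : cjH (-σ) (cjH σ H) = H := by
  rw [cjH_cjH, neg_add_cancel, cjH_zero]

theorem IsRegular.cjH {H : Subgroup (Hol G)} (hH : Hol.IsRegular H) (σ : AddAut G) :
    Hol.IsRegular (cjH σ H) := by
  rw [isRegular_iff] at hH ⊢
  constructor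
  · intro x
    obtain ⟨h, hh, e⟩ := hH.1 ((-σ) x)
    exact ⟨_, ⟨h, hh, rfl⟩, by
      change (((0, σ) : Hol G) * h * ((0, σ) : Hol G)⁻¹).1 = x
      rw [conj_aut_fst, e, apply_neg_apply]⟩
  · rintro _ ⟨g, hg, rfl⟩ _ ⟨h, hh, rfl⟩ e
    change (((0, σ) : Hol G) * g * ((0, σ) : Hol G)⁻¹).1 =
      (((0, σ) : Hol G) * h * ((0, σ) : Hol G)⁻¹).1 at e
    rw [conj_aut_fst, conj_aut_fst] at e
    rw [hH.2 g hg h hh (σ.injective e)]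

theorem el_cjH {H : Subgroup (Hol G)} (hH : Hol.IsRegular H) (σ : AddAut G) (x : G) :
    el (cjH σ H) x = (0, σ) * el H ((-σ) x) * (0, σ)⁻¹ := by
  refine el_eq (IsRegular.cjH hH σ) (mem_cjH.2 ⟨_, el_mem hH _, rfl⟩) ?_
  rw [conj_aut_fst, el_fst hH, apply_neg_apply]

/-- Conjugacy of regular subgroups only involves automorphisms. -/
theorem conjugate_iff {H₁ H₂ : Subgroup (Hol G)} (h₁ : Hol.IsRegular H₁) :
    ConjugateSubgroups H₁ H₂ ↔ ∃ σ, cjH σ H₁ = H₂ := by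
  constructor
  · rintro ⟨g, rfl⟩
    obtain ⟨v, hv, hvg⟩ := (isRegular_iff.1 h₁).1 g⁻¹.1
    have hgv : g * v = (0, g.2 + v.2) := by
      refine Prod.ext ?_ rfl
      rw [mul_fst, hvg, ← mul_fst, mul_inv_cancel]
      rfl
    refine ⟨g.2 + v.2, ?_⟩
    ext y
    rw [mem_cjH, ← hgv]
    change _ ↔ ∃ h ∈ H₁, g * h * g⁻¹ = y
    constructor
    · rintro ⟨h, hh, rfl⟩
      exact ⟨v * h * v⁻¹, mul_mem (mul_mem hv hh) (inv_mem hv), by group⟩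
    · rintro ⟨h, hh, rfl⟩
      exact ⟨v⁻¹ * h * v, mul_mem (mul_mem (inv_mem hv) hh) hv, by group⟩
  · rintro ⟨σ, rfl⟩
    exact ⟨_, rfl⟩

theorem lev_mul_inv_lt {g h : Hol G} (hg : g.2 ∈ autS) (hh : h.2 ∈ autS) (hl : lev g.1 = lev h.1)
    (h0 : lev g.1 ≠ 0) : lev (g * h⁻¹).1 < lev g.1 := by
  have e : (g * h⁻¹).1 = g.1 - (g.2 + -h.2) h.1 := by
    rw [mul_fst, inv_fst, map_neg, sub_eq_add_neg, AddAut.add_apply]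
  rw [e]
  refine lev_sub_lt ?_ h0
  rw [mem_autS.1 (add_mem hg (neg_mem hh)), hl]

/-- A criterion for the inclusion of subgroups. -/
theorem le_of_common_elements {H H' : Subgroup (Hol G)} (hH : Hol.IsRegular H)
    (hS : H ≤ holOf autS)
    (hc : ∀ i, 0 < i → i ≤ 6 → (∀ h ∈ H, lev h.1 = i → h ∈ H') ∨ ∃ h ∈ H, h ∈ H' ∧ lev h.1 = i) :
    H ≤ H' := by
  have key : ∀ i, ∀ h ∈ H, lev h.1 = i → h ∈ H' := by
    intro i
    induction i using Nat.strong_induction_on with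
    | _ i ih =>
      intro h hh hl
      rcases Nat.eq_zero_or_pos i with rfl | hi
      · have : h = 1 := (isRegular_iff.1 hH).2 _ hh _ (one_mem _) (lev_eq_zero.1 hl)
        rw [this]
        exact one_mem _
      · rcases hc i hi (hl ▸ lev_le _) with hc | ⟨e, he, he', hel⟩
        · exact hc h hh hl
        · have hlt := lev_mul_inv_lt (hS hh) (hS he) (hl.trans hel.symm) (by omega)
          have := ih _ (hl ▸ hlt) _ (mul_mem hh (inv_mem he)) rfl
          simpa using mul_mem this he'
  exact fun h hh => key _ h hh rfl

/-! ### Canonical representatives -/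

/-- The list of codes of the elements with given translation parts. -/
noncomputable def keys (ks : List G) (H : Subgroup (Hol G)) : List ℕ := ks.map fun k => enc (el H k)

/-- The distinguished elements. -/
def allKeys : List G := [(0, 0, 8), (0, 0, 4), (0, 0, 2), ga, gb, gc]

theorem exists_key : ∀ i, 0 < i → i ≤ 6 → ∃ k ∈ allKeys, lev k = i := by
  intro i h0 h6
  interval_cases i
  · exact ⟨(0, 0, 8), by decide, by decide⟩
  · exact ⟨(0, 0, 4), by decide, by decide⟩
  · exact ⟨(0, 0, 2), by decide, by decide⟩
  · exact ⟨ga, by decide, by decide⟩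
  · exact ⟨gb, by decide, by decide⟩
  · exact ⟨gc, by decide, by decide⟩

theorem le_of_keys_eq {H H' : Subgroup (Hol G)} (hH : Hol.IsRegular H) (hS : H ≤ holOf autS)
    (hH' : Hol.IsRegular H') (e : keys allKeys H = keys allKeys H') : H ≤ H' := by
  refine le_of_common_elements hH hS fun i h0 h6 => Or.inr ?_
  obtain ⟨k, hk, hl⟩ := exists_key i h0 h6
  have : el H k = el H' k := enc_injective (List.map_inj_left.1 e k hk)
  exact ⟨el H k, el_mem hH k, this ▸ el_mem hH' k, by rw [el_fst hH, hl]⟩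

theorem keys_injective {H H' : Subgroup (Hol G)} (hH : Hol.IsRegular H) (hS : H ≤ holOf autS)
    (hH' : Hol.IsRegular H') (hS' : H' ≤ holOf autS) (e : keys allKeys H = keys allKeys H') :
    H = H' :=
  le_antisymm (le_of_keys_eq hH hS hH' e) (le_of_keys_eq hH' hS' hH e.symm)

/-- The regular subgroups that are enumerated. -/
def regIn (A : AddSubgroup (AddAut G)) (nq : Bool) : Set (Subgroup (Hol G)) :=
  {H | Hol.IsRegular H ∧ H ≤ holOf A ∧ (nq = true → ¬ H ≤ holOf autQ)}

/-- Minimality among the conjugates by the automorphisms in `T`. -/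
def IsCanon (T : List (AddAut G)) (ks : List G) (H : Subgroup (Hol G)) : Prop :=
  ∀ σ ∈ T, keys ks H ≤ keys ks (cjH σ H)

/-! ### Precomputed data of elements -/

theorem digC_mCode (x : Mat) (hx : x.Small) (i j : Fin 4) :
    digC (mCode x) (3 - i.val + 4 * j.val) = x i j := by
  have := mCode_digit x hx (i, j)
  rw [← this]
  change (mCode x >>> (10 * (3 - i.val + 4 * j.val))) % 1024 = _
  rw [Nat.shiftRight_eq_div_pow, pow_mul]
  norm_num

set_option exponentiation.threshold 1000 in
theorem toR_enc (h : Hol G) : toR (enc h) = encR h := by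
  have hd := digC_mCode (holMat h) (holMat_small h)
  unfold toR enc encR rCode
  generalize mCode (holMat h) = m at *
  generalize holMat h = x at *
  have e : ∀ i j : Fin 4, x i j = digC m (3 - i.val + 4 * j.val) := fun i j => (hd i j).symm
  simp only [Fintype.sum_prod_type, Fin.sum_univ_four, e]
  generalize digC m = d
  simp
  ring

theorem one_eq : (1 : Hol G) = (0, 0) := rfl

theorem mOne_add_colCode (k : G) : mOne + colCode k = enc (k, 0) := by
  rw [enc_translate, mOne_enc, one_eq]

theorem mk_inv (k : G) (α : AddAut G) : ((k, α) : Hol G)⁻¹ = (0, α)⁻¹ * (-k, 0) := by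
  refine Prod.ext ?_ ?_
  · simp [inv_fst, mul_fst, inv_snd]
  · simp [inv_snd, mul_snd]

/-- The data of the element `(k, α)`. -/
def ce (k : G) (α : AddAut G) : CE := mkCE (colCode k) (colCode (-k)) (ae α)
/-- The data of an automorphism. -/
def te (σ : AddAut G) : TE := mkTE (ae σ)
/-- The data of the element `(gc, α)`. -/
def ge (α : AddAut G) : GE := mkGE (ae α)

theorem ce_m (k : G) (α : AddAut G) : (ce k α).m = enc (k, α) := (enc_translate k α).symm

theorem ce_l (k : G) (α : AddAut G) : (ce k α).l = encL (k, α) := by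
  have : (ce k α).l = toL (ce k α).m := rfl
  rw [this, ce_m, toL_enc]

theorem ce_r (k : G) (α : AddAut G) : (ce k α).r = encR (k, α)⁻¹ := by
  have : (ce k α).r = toR (mul2 (enc (0, α)⁻¹) (mOne + colCode (-k))) := rfl
  rw [this, mOne_add_colCode, mul2_enc, ← mk_inv, toR_enc]

theorem te_s (σ : AddAut G) : (te σ).s = encL (0, σ) := toL_enc _

theorem te_si (σ : AddAut G) : (te σ).si = encR (0, σ)⁻¹ := toR_enc _

theorem idxC_preimage (σ : AddAut G) (k : G) :
    idxC (mul2 (enc (0, σ)⁻¹) (mOne + colCode k)) = slot ((-σ) k) := by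
  rw [mOne_add_colCode, mul2_enc, idxC_enc]
  simp [mul_fst, inv_fst, inv_snd]

theorem te_p8 (σ : AddAut G) : (te σ).p8 = slot ((-σ) (0, 0, 8)) := idxC_preimage σ (0, 0, 8)
theorem te_p4 (σ : AddAut G) : (te σ).p4 = slot ((-σ) (0, 0, 4)) := idxC_preimage σ (0, 0, 4)
theorem te_p2 (σ : AddAut G) : (te σ).p2 = slot ((-σ) (0, 0, 2)) := idxC_preimage σ (0, 0, 2)
theorem te_pa (σ : AddAut G) : (te σ).pa = slot ((-σ) ga) := idxC_preimage σ ga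
theorem te_pb (σ : AddAut G) : (te σ).pb = slot ((-σ) gb) := idxC_preimage σ gb
theorem te_pc (σ : AddAut G) : (te σ).pc = slot ((-σ) gc) := idxC_preimage σ gc

theorem ge_m (α : AddAut G) : (ge α).m = enc (gc, α) := (enc_translate gc α).symm

theorem ge_l (α : AddAut G) : (ge α).l = encL (gc, α) := by
  have : (ge α).l = toL (ge α).m := rfl
  rw [this, ge_m, toL_enc]

theorem ge_r (α : AddAut G) : (ge α).r = encR (gc, α)⁻¹ := by
  have : (ge α).r = toR (mul2 (enc (0, α)⁻¹) (mOne + colCode (-gc))) := rfl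
  rw [this, mOne_add_colCode, mul2_enc, ← mk_inv, toR_enc]

theorem ge_g2 (α : AddAut G) : (ge α).g2 = enc ((gc, α) * (gc, α)) := by
  have : (ge α).g2 = pw2 (ge α).m := rfl
  rw [this, ge_m, pw2_enc]

theorem ge_g4 (α : AddAut G) :
    (ge α).g4 = enc ((gc, α) * (gc, α) * ((gc, α) * (gc, α))) := by
  have : (ge α).g4 = pw2 (ge α).g2 := rfl
  rw [this, ge_g2, pw2_enc]

theorem ge_g8 (α : AddAut G) : (ge α).g8 = enc ((gc, α) * (gc, α) * ((gc, α) * (gc, α)) *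
    ((gc, α) * (gc, α) * ((gc, α) * (gc, α)))) := by
  have : (ge α).g8 = pw2 (ge α).g4 := rfl
  rw [this, ge_g4, pw2_enc]

/-! ### Correctness of the enumeration -/

/-- The number of canonical regular subgroups containing `K`. -/
noncomputable def cnt (A : AddSubgroup (AddAut G)) (nq : Bool) (K : Subgroup (Hol G))
    (T : List (AddAut G)) (ks : List G) : ℕ :=
  {H | H ∈ regIn A nq ∧ K ≤ H ∧ IsCanon T ks H}.ncard

/-- A node describes the subgroup `K`, the automorphisms `T`, and the
candidates `Γ` for the last level. -/
structure NodeOK (A : AddSubgroup (AddAut G)) (nq : Bool) (i : ℕ) (n : Node)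
    (K : Subgroup (Hol G)) (T Γ : List (AddAut G)) : Prop where
  isLev : IsLev i K
  le : K ≤ holOf A
  arr_ok : ArrOK Prod.fst n.arr K
  els_eq : ∃ l : List (Hol G), n.els = l.map encL ∧ ∀ h, h ∈ l ↔ h ∈ K
  gs_eq : ∃ l : List (Hol G), n.gs = l.map enc ∧ Subgroup.closure {x | x ∈ l} = K
  T_eq : n.T = T.map te
  Γ_eq : n.Γ = Γ.map ge
  nodup : Γ.Nodup
  mem_A : ∀ α ∈ Γ, α ∈ A
  all_mem : ∀ H ∈ regIn A nq, K ≤ H → (el H gc).2 ∈ Γ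

section Correctness

variable {A : AddSubgroup (AddAut G)} {nq : Bool} {i : ℕ} {n : Node} {K H : Subgroup (Hol G)}
  {T Γ : List (AddAut G)} {k : G} {α : AddAut G}

theorem regIn.inj (hH : H ∈ regIn A nq) : ∀ g ∈ H, ∀ h ∈ H, g.1 = h.1 → g = h :=
  (isRegular_iff.1 hH.1).2

/-- The conditions tested by `candC`. -/
theorem candC_iff {arr : ℕ} (hK : IsLev i K) (harr : ArrOK Prod.fst arr K) (gl : List (Hol G)) :
    candC arr (gl.map enc) (ce k α) = true ↔
      (k, α) * (k, α) ∈ K ∧ ∀ g ∈ gl, (k, α) * g * (k, α)⁻¹ ∈ K := by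
  have hm := fun w => membC_enc harr hK.inj w
  unfold candC
  rw [andC_iff, allC_iff, ce_l, ce_m, ce_r, mul3_one_enc, hm]
  refine and_congr Iff.rfl ?_
  rw [List.forall_mem_map]
  refine forall₂_congr fun g _ => ?_
  rw [conjIn, mul3_enc, hm]
  rfl

theorem IsLev.sq_mem (hK : IsLev i K) (hAS : A ≤ autS) (hH : H ∈ regIn A nq) (hKH : K ≤ H)
    {h : Hol G} (hh : h ∈ H) (hl : lev h.1 = i + 1) : h * h ∈ K :=
  hK.mem_of_le hKH (regIn.inj hH) (mul_mem hh hh) (lev_sq_le (hAS (hH.2.1 hh)) hl)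

theorem IsLev.conj_mem (hK : IsLev i K) (hAS : A ≤ autS) (hH : H ∈ regIn A nq) (hKH : K ≤ H)
    {h : Hol G} (hh : h ∈ H) (hl : lev h.1 = i + 1) {g : Hol G} (hg : g ∈ K) : h * g * h⁻¹ ∈ K :=
  hK.mem_of_le hKH (regIn.inj hH) (mul_mem (mul_mem hh (hKH hg)) (inv_mem hh))
    (lev_conj_le (hAS (hH.2.1 hh)) (hK.mem hg) hl (hK.le g hg))

/-- Adding a generator to the subgroup of a node. -/
theorem NodeOK.exists_child (hn : NodeOK A nq i n K T Γ) (hAS : A ≤ autS) (hα : α ∈ A)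
    (hk : lev k = i + 1) (hc : candC n.arr n.gs (ce k α) = true) :
    ∃ K' : Subgroup (Hol G), IsLev (i + 1) K' ∧ K' ≤ holOf A ∧
      (∀ H : Subgroup (Hol G), K' ≤ H ↔ K ≤ H ∧ (k, α) ∈ H) ∧
      ArrOK Prod.fst (fillC (enc (k, α)) n.els n.arr) K' ∧
      (∃ l : List (Hol G), enc (k, α) :: n.gs = l.map enc ∧ Subgroup.closure {x | x ∈ l} = K') ∧
      ∀ T' Γ' : List (AddAut G), Γ'.Nodup → (∀ α ∈ Γ', α ∈ A) →
        (∀ H ∈ regIn A nq, K' ≤ H → (el H gc).2 ∈ Γ') →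
        NodeOK A nq (i + 1) (child (enc (k, α)) n (T'.map te) (Γ'.map ge)) K' T' Γ' := by
  obtain ⟨gl, hgl, hcl⟩ := hn.gs_eq
  obtain ⟨l, hl, hlK⟩ := hn.els_eq
  rw [hgl, candC_iff hn.isLev hn.arr_ok] at hc
  have hlev : IsLev (i + 1) (Subgroup.closure {x | x ∈ (k, α) :: gl}) :=
    hn.isLev.closure_insert hcl (hAS hα) hk hc.1 hc.2
  have hmem := mem_closure_insert hcl hc.1 hc.2
  generalize hK' : Subgroup.closure {x | x ∈ (k, α) :: gl} = K' at *
  have hle : ∀ H : Subgroup (Hol G), K' ≤ H ↔ K ≤ H ∧ (k, α) ∈ H := by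
    intro H
    constructor
    · exact fun h => ⟨fun x hx => h ((hmem x).2 (Or.inl hx)),
        h ((hmem _).2 (Or.inr ⟨1, one_mem _, by simp⟩))⟩
    · rintro ⟨h1, h2⟩ x hx
      rcases (hmem x).1 hx with hx | ⟨y, hy, rfl⟩
      · exact h1 hx
      · exact mul_mem (h1 hy) h2
  have hA : K' ≤ holOf A := (hle _).2 ⟨hn.le, hα⟩
  have harr : ArrOK Prod.fst (fillC (enc (k, α)) n.els n.arr) K' := by
    have := fillC_enc (M := K) (N := K') hlev.inj (fun x hx => (hmem x).2 (Or.inl hx)) (k, α) l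
      (fun x hx => (hmem _).2 (Or.inr ⟨x, (hlK x).1 hx, rfl⟩)) hn.arr_ok
    rw [hl]
    convert this using 1
    ext x
    simp only [SetLike.mem_coe, hmem, Set.mem_union, Set.mem_ofPred_eq, hlK]
  have hgs : ∃ l : List (Hol G), enc (k, α) :: n.gs = l.map enc ∧
      Subgroup.closure {x | x ∈ l} = K' :=
    ⟨(k, α) :: gl, by rw [hgl, List.map_cons], hK'⟩
  refine ⟨K', hlev, hA, hle, harr, hgs, fun T' Γ' h1 h2 h3 => ?_⟩
  refine ⟨hlev, hA, harr, ⟨l.map (· * (k, α)) ++ l, ?_, ?_⟩, hgs, rfl, rfl, h1, h2, h3⟩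
  · change mapMul _ n.els n.els = _
    rw [hl, mapMul_enc]
  · intro x
    rw [hmem, List.mem_append, List.mem_map, hlK, or_comm]
    simp only [hlK, eq_comm]

theorem cand_of_mem (hn : NodeOK A nq i n K T Γ) (hAS : A ≤ autS) (hk : lev k = i + 1)
    (hH : H ∈ regIn A nq) (hKH : K ≤ H) (hh : (k, α) ∈ H) :
    candC n.arr n.gs (ce k α) = true := by
  obtain ⟨gl, hgl, hcl⟩ := hn.gs_eq
  rw [hgl, candC_iff hn.isLev hn.arr_ok]
  refine ⟨hn.isLev.sq_mem hAS hH hKH hh hk, fun g hg => hn.isLev.conj_mem hAS hH hKH hh hk ?_⟩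
  rw [← hcl]
  exact Subgroup.subset_closure hg

/-- Distribution of the subgroups according to one of their elements. -/
theorem ncard_eq_sum {P : Subgroup (Hol G) → Prop} {L : List (AddAut G)} (hL : L.Nodup) (k : G)
    (hP : ∀ H, P H → Hol.IsRegular H ∧ (el H k).2 ∈ L) :
    {H | P H}.ncard = (L.map fun α => {H | P H ∧ (k, α) ∈ H}.ncard).sum := by
  classical
  have : Finite (Hol G) := inferInstance
  have : Fintype (Subgroup (Hol G)) := Fintype.ofFinite _
  have hmem : ∀ H, P H → ∀ α, (k, α) ∈ H ↔ (el H k).2 = α := by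
    intro H hH α
    have hr := (hP H hH).1
    constructor
    · intro h
      rw [el_eq hr h rfl]
    · rintro rfl
      have := el_mem hr k
      rwa [show el H k = (k, (el H k).2) from Prod.ext (el_fst hr k) rfl] at this
  rw [← List.sum_toFinset _ hL, Set.ncard_eq_toFinset_card',
    Finset.card_eq_sum_card_fiberwise (f := fun H => (el H k).2) (t := L.toFinset)]
  · refine Finset.sum_congr rfl fun α _ => ?_
    rw [Set.ncard_eq_toFinset_card']
    congr 1
    ext H
    simp only [Finset.mem_filter, Set.mem_toFinset, Set.mem_ofPred_eq]
    exact and_congr_right fun h => (hmem H h α).symm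
  · intro H hH
    simpa using (hP H (by simpa using hH)).2

theorem keys_cons (ks : List G) (H : Subgroup (Hol G)) :
    keys (k :: ks) H = enc (el H k) :: keys ks H := rfl

theorem cons_le_cons_iff {a b : ℕ} {s t : List ℕ} :
    a :: s ≤ b :: t ↔ a < b ∨ a = b ∧ s ≤ t := by
  rw [← not_lt, List.cons_lt_cons_iff, ← not_lt (a := t)]
  grind

/-- Comparison of one entry. -/
theorem chkT_correct (hK : IsLev i K) {arr : ℕ} (harr : ArrOK Prod.fst arr K)
    (hk : lev k ≤ i) {ka : ℕ} (hka : ka = slot k) {pos : TE → ℕ}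
    (hpos : ∀ σ, pos (te σ) = slot ((-σ) k)) (cont : List TE → ℕ) (ks : List G)
    (T : List (AddAut G)) :
    (chkT arr (getC arr ka) pos cont (T.map te) [] = 0 ∧
      ∀ H ∈ regIn A nq, K ≤ H → ¬ IsCanon T (k :: ks) H) ∨
    ∃ T' : List (AddAut G), chkT arr (getC arr ka) pos cont (T.map te) [] = cont (T'.map te) ∧
      ((∀ H ∈ regIn A nq, K ≤ H → (IsCanon T (k :: ks) H ↔ IsCanon T' (k :: ks) H)) ∧
      ((∀ σ : AddAut G, lev ((-σ) k) ≤ i) →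
        ∀ H ∈ regIn A nq, K ≤ H → (IsCanon T (k :: ks) H ↔ IsCanon T' ks H))) := by
  have hget : ∀ H ∈ regIn A nq, K ≤ H → ∀ x, getC arr (slot x) ≠ 0 →
      getC arr (slot x) = enc (el H x) := by
    intro H hH hKH x hx
    rcases harr x with ⟨h, hh, rfl, e⟩ | ⟨e, -⟩
    · rw [e, el_eq hH.1 (hKH hh) rfl]
    · exact absurd e hx
  have hne : ∀ x, lev x ≤ i → getC arr (slot x) ≠ 0 := by
    intro x hx
    obtain ⟨h, hh, rfl⟩ := hK.cover x hx
    rw [harr.get hK.inj hh]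
    exact enc_pos h
  have hcj : ∀ H ∈ regIn A nq, K ≤ H → ∀ σ, getC arr (pos (te σ)) ≠ 0 →
      mul3 (te σ).s (getC arr (pos (te σ))) (te σ).si = enc (el (cjH σ H) k) := by
    intro H hH hKH σ h0
    rw [hpos] at h0 ⊢
    rw [hget H hH hKH _ h0, te_s, te_si, mul3_enc, el_cjH hH.1]
  have hv : ∀ H ∈ regIn A nq, K ≤ H → getC arr ka = enc (el H k) := by
    intro H hH hKH
    rw [hka, hget H hH hKH _ (hne k hk)]
  rcases chkT_spec te arr (getC arr ka) pos cont T [] with ⟨e, σ, hσ, h0, hlt⟩ |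
      ⟨T', e, hsub, -, heq, hall⟩
  · refine Or.inl ⟨e, fun H hH hKH hcan => ?_⟩
    have := hcan σ hσ
    rw [keys_cons, keys_cons, cons_le_cons_iff] at this
    rw [hcj H hH hKH σ h0, hv H hH hKH] at hlt
    omega
  · refine Or.inr ⟨T', e, ?_, ?_⟩
    · intro H hH hKH
      constructor
      · exact fun h σ hσ => h σ (by simpa using hsub σ hσ)
      · intro h σ hσ
        rcases hall σ hσ with h' | ⟨h0, hlt⟩
        · exact h σ h'
        · rw [hcj H hH hKH σ h0, hv H hH hKH] at hlt
          rw [keys_cons, keys_cons, cons_le_cons_iff]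
          exact Or.inl hlt
    · intro hlev H hH hKH
      have hnz : ∀ σ, getC arr (pos (te σ)) ≠ 0 := fun σ => by
        rw [hpos]
        exact hne _ (hlev σ)
      constructor
      · intro h σ hσ
        have h1 := h σ (by simpa using hsub σ hσ)
        rw [keys_cons, keys_cons, cons_le_cons_iff] at h1
        rcases heq σ hσ with h' | h' | h'
        · simp at h'
        · exact absurd h' (hnz σ)
        · rw [hcj H hH hKH σ (hnz σ), hv H hH hKH] at h'
          rcases h1 with h1 | h1
          · omega
          · exact h1.2
      · intro h σ hσ
        rw [keys_cons, keys_cons, cons_le_cons_iff]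
        rcases hall σ hσ with h' | ⟨h0, hlt⟩
        · have h1 := h σ h'
          rcases heq σ h' with h2 | h2 | h2
          · simp at h2
          · exact absurd h2 (hnz σ)
          · rw [hcj H hH hKH σ (hnz σ), hv H hH hKH] at h2
            exact Or.inr ⟨h2.symm, h1⟩
        · rw [hcj H hH hKH σ h0, hv H hH hKH] at hlt
          exact Or.inl hlt

theorem snd_mem_of_mem (hH : H ∈ regIn A nq) {h : Hol G} (hh : h ∈ H) : h.2 ∈ A := hH.2.1 hh

theorem softC_of_mem (hH : H ∈ regIn A nq) (hKH : K ≤ H) {arr : ℕ}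
    (harr : ArrOK Prod.fst arr K) {w : Hol G} (hw : w ∈ H) : softC arr (enc w) = true :=
  softC_enc harr fun g hg e => regIn.inj hH g (hKH hg) w hw e

theorem mulM_rOne (g : Hol G) : mulM (encP g) rOne = enc g := by
  rw [rOne_enc, mulM_enc, mul_one]

theorem el_gc (hH : H ∈ regIn A nq) : (gc, (el H gc).2) ∈ H := by
  have := el_mem hH.1 gc
  rwa [show el H gc = (gc, (el H gc).2) from Prod.ext (el_fst hH.1 gc) rfl] at this

/-- The conditions of `okG` are necessary. -/
theorem okG_of_mem (hH : H ∈ regIn A nq) (hKH : K ≤ H) {arr : ℕ} (harr : ArrOK Prod.fst arr K)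
    {h : Hol G} (hh : h ∈ H) : okG arr (enc h) (ge (el H gc).2) = true := by
  have hg := el_gc hH
  have hs : ∀ w ∈ H, softC arr (enc w) = true := fun w hw => softC_of_mem hH hKH harr hw
  generalize (el H gc).2 = α at *
  have hgh := mul_mem hg hh
  have hg2 := mul_mem hg hg
  have hg4 := mul_mem hg2 hg2
  unfold okG
  simp only [andC_iff, ge_g2, ge_g4, ge_g8, ge_l, ge_r, mulP_enc, mulM_enc, mulL_enc, mulM_rOne,
    mul3_one_enc]
  have hgh2 := mul_mem hgh hgh
  exact ⟨hs _ hg2, hs _ hg4, hs _ (mul_mem hg4 hg4), hs _ (mul_mem hgh (inv_mem hg)), hs _ hgh2,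
    hs _ (mul_mem hgh2 hgh2)⟩

theorem tryS_eq (ka : ℕ) (pos : TE → ℕ) (cont : Node → ℕ) (n : Node) (h : ℕ) :
    tryS ka pos cont n h = chkT (fillC h n.els n.arr) (getC (fillC h n.els n.arr) ka) pos
      (fun T => filtG (okG (fillC h n.els n.arr) h) (fun Γ => cont (child h n T Γ)) n.Γ [])
      n.T [] := rfl

theorem try5_eq (nq : Bool) (cont : Node → ℕ) (n : Node) (h : ℕ) :
    try5 nq cont n h = filtG (okX (andC nq (allC inQC (h :: n.gs))) (fillC h n.els n.arr)
      (h :: n.gs)) (fun Γ => chkT (fillC h n.els n.arr) (getC (fillC h n.els n.arr) (nat_lit 32))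
        TE.pa (fun T => chkT (fillC h n.els n.arr) (getC (fillC h n.els n.arr) (nat_lit 16)) TE.pb
          (fun T => cont (child h n T Γ)) T []) n.T []) n.Γ [] := rfl

theorem stepS_correct (hAS : A ≤ autS) {L : List (AddAut G)} (hL : L.Nodup)
    (hLA : ∀ α, α ∈ L ↔ α ∈ A) (hk : lev k = i + 1) {ka : ℕ} (hka : ka = slot k) {pos : TE → ℕ}
    (hpos : ∀ σ, pos (te σ) = slot ((-σ) k)) {ks ks' : List G}
    (hks : ks' = k :: ks ∨ ks' = ks ∧ ∀ σ : AddAut G, lev ((-σ) k) ≤ i + 1) {cont : Node → ℕ}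
    (hcont : ∀ n K T Γ, NodeOK A nq (i + 1) n K T Γ → cont n = cnt A nq K T ks')
    (hn : NodeOK A nq i n K T Γ) :
    stepS (L.map (ce k)) ka pos cont n = cnt A nq K T (k :: ks) := by
  have hdist := ncard_eq_sum (P := fun H => H ∈ regIn A nq ∧ K ≤ H ∧ IsCanon T (k :: ks) H) hL k
    fun H hH => ⟨hH.1.1, (hLA _).2 (snd_mem_of_mem hH.1 (el_mem hH.1.1 k))⟩
  rw [cnt, hdist, stepS, sumL_eq, List.map_map]
  refine congrArg List.sum (List.map_congr_left fun α hα => ?_)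
  rw [Function.comp_apply]
  rw [iteC_eq]
  split_ifs with hc
  · obtain ⟨K', hlev, -, hle, harr, -, hchild⟩ := hn.exists_child hAS ((hLA α).1 hα) hk hc
    have hset : {H | (H ∈ regIn A nq ∧ K ≤ H ∧ IsCanon T (k :: ks) H) ∧ (k, α) ∈ H} =
        {H | H ∈ regIn A nq ∧ K' ≤ H ∧ IsCanon T (k :: ks) H} := by
      ext H
      simp only [Set.mem_ofPred_eq, hle]
      tauto
    rw [hset, ce_m, tryS_eq, hn.T_eq]
    rcases chkT_correct (A := A) (nq := nq) hlev harr hk.le hka hpos (fun T =>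
        filtG (okG (fillC (enc (k, α)) n.els n.arr) (enc (k, α)))
        (fun Γ => cont (child (enc (k, α)) n T Γ)) n.Γ []) ks T with ⟨e, hno⟩ | ⟨T', e, hsoft, hcons⟩
    · rw [e, eq_comm, Set.ncard_eq_zero]
      ext H
      simp only [Set.mem_ofPred_eq, Set.mem_empty_iff_false, iff_false]
      exact fun h => hno H h.1 h.2.1 h.2.2
    · have hT' : ∀ H ∈ regIn A nq, K' ≤ H → (IsCanon T (k :: ks) H ↔ IsCanon T' ks' H) := by
        rcases hks with rfl | ⟨rfl, h⟩
        · exact hsoft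
        · exact hcons h
      have hset : {H | H ∈ regIn A nq ∧ K' ≤ H ∧ IsCanon T (k :: ks) H} =
          {H | H ∈ regIn A nq ∧ K' ≤ H ∧ IsCanon T' ks' H} := by
        ext H
        simp only [Set.mem_ofPred_eq]
        exact and_congr_right fun h1 => and_congr_right fun h2 => hT' H h1 h2
      have hok : ∀ H ∈ regIn A nq, K' ≤ H → (el H gc).2 ∈ Γ ∧
          okG (fillC (enc (k, α)) n.els n.arr) (enc (k, α)) (ge (el H gc).2) = true :=
        fun H hH hKH => ⟨hn.all_mem H hH ((hle H).1 hKH).1,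
          okG_of_mem hH hKH harr ((hle H).1 hKH).2⟩
      rw [e, hset, hn.Γ_eq]
      rcases filtG_spec ge (okG (fillC (enc (k, α)) n.els n.arr) (enc (k, α)))
        (fun Γ => cont (child (enc (k, α)) n (T'.map te) Γ)) Γ hn.nodup with
        ⟨e, hno⟩ | ⟨Γ', e, hnd, hΓ'⟩
      · rw [e, eq_comm, Set.ncard_eq_zero]
        ext H
        simp only [Set.mem_ofPred_eq, Set.mem_empty_iff_false, iff_false]
        rintro ⟨h1, h2, -⟩
        have := hok H h1 h2
        rw [hno _ this.1] at this
        exact absurd this.2 (by simp)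
      · rw [e]
        exact hcont _ _ _ _ (hchild T' Γ' hnd (fun β hβ => hn.mem_A β ((hΓ' β).1 hβ).1)
          fun H h1 h2 => (hΓ' _).2 (hok H h1 h2))
  · rw [eq_comm, Set.ncard_eq_zero]
    ext H
    simp only [Set.mem_ofPred_eq, Set.mem_empty_iff_false, iff_false]
    rintro ⟨⟨h1, h2, -⟩, h3⟩
    exact hc (cand_of_mem hn hAS hk h1 h2 h3)

theorem lev_gc : lev gc = 5 + 1 := by decide

/-- A regular subgroup is generated by its part of level `5` and an element of level `6`. -/
theorem le_of_top (hAS : A ≤ autS) (hK : IsLev 5 K) (hH : H ∈ regIn A nq) (hKH : K ≤ H)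
    (hg : (gc, α) ∈ H) {M : Subgroup (Hol G)} (hKM : K ≤ M) (hgM : (gc, α) ∈ M) : H ≤ M := by
  refine le_of_common_elements hH.1 (fun h hh => hAS (hH.2.1 hh)) fun i h0 h6 => ?_
  rcases h6.lt_or_eq with h | rfl
  · exact Or.inl fun h hh hl => hKM (hK.mem_of_le hKH (regIn.inj hH) hh (by omega))
  · exact Or.inr ⟨_, hg, hgM, lev_gc⟩

theorem isRegular_of_isLev (hK : IsLev 6 K) : Hol.IsRegular K :=
  isRegular_iff.2 ⟨fun x => hK.cover x (lev_le x), hK.inj⟩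

/-- The conditions of `okX` are necessary and sufficient. -/
theorem okX_iff (hAS : A ≤ autS) (hK : IsLev 5 K) (hKA : K ≤ holOf A) {arr : ℕ}
    (harr : ArrOK Prod.fst arr K) {l : List (Hol G)} (hl : Subgroup.closure {x | x ∈ l} = K)
    (hα : α ∈ A) : okX (andC nq (allC inQC (l.map enc))) arr (l.map enc) (ge α) = true ↔
      ∃ H ∈ regIn A nq, K ≤ H ∧ (gc, α) ∈ H := by
  have hm := fun w => membC_enc harr hK.inj w
  have hlK : ∀ g ∈ l, g ∈ K := fun g hg => hl ▸ Subgroup.subset_closure hg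
  have hq : andC (andC nq (allC inQC (l.map enc))) (inQC (ge α).m) = true ↔
      nq = true ∧ K ≤ holOf autQ ∧ α ∈ autQ := by
    rw [andC_iff, andC_iff, allC_iff, List.forall_mem_map, ge_m, inQC_enc, and_assoc]
    refine and_congr_right fun _ => and_congr ?_ ?_
    · rw [← hl, Subgroup.closure_le]
      refine forall₂_congr fun g hg => ?_
      rw [inQC_enc]
      exact ⟨fun h => ⟨hAS (hKA (hlK g hg)), h⟩, fun h => h.2⟩
    · exact ⟨fun h => ⟨hAS hα, h⟩, fun h => h.2⟩
  have hval : okX (andC nq (allC inQC (l.map enc))) arr (l.map enc) (ge α) = true ↔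
      ¬ (nq = true ∧ K ≤ holOf autQ ∧ α ∈ autQ) ∧ (gc, α) * (gc, α) ∈ K ∧
        ∀ g ∈ l, (gc, α) * g * (gc, α)⁻¹ ∈ K := by
    unfold okX
    rw [andC_iff, andC_iff, allC_iff, List.forall_mem_map, ge_g2, ge_l, ge_r, hm, iteC_eq, ← hq]
    refine and_congr (by simp) (and_congr Iff.rfl ?_)
    refine forall₂_congr fun g _ => ?_
    rw [conjIn, mul3_enc, hm]
    rfl
  rw [hval]
  constructor
  · rintro ⟨h1, h2, h3⟩
    have hmem := mem_closure_insert hl h2 h3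
    have hlev := hK.closure_insert hl (hAS hα) lev_gc h2 h3
    have hg : (gc, α) ∈ Subgroup.closure {x | x ∈ (gc, α) :: l} :=
      (hmem _).2 (Or.inr ⟨1, one_mem _, by simp⟩)
    have hKH : K ≤ Subgroup.closure {x | x ∈ (gc, α) :: l} := fun x hx => (hmem x).2 (Or.inl hx)
    refine ⟨_, ⟨isRegular_of_isLev hlev, fun x hx => ?_, fun hn hQ => ?_⟩, hKH, hg⟩
    · rcases (hmem x).1 hx with hx | ⟨y, hy, rfl⟩
      · exact hKA hx
      · exact mul_mem (hKA hy) (show ((gc, α) : Hol G) ∈ holOf A from hα)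
    · exact h1 ⟨hn, hKH.trans hQ, hQ hg⟩
  · rintro ⟨H, hH, hKH, hg⟩
    refine ⟨?_, hK.sq_mem hAS hH hKH hg lev_gc,
      fun g hgl => hK.conj_mem hAS hH hKH hg lev_gc (hlK g hgl)⟩
    rintro ⟨h1, h2, h3⟩
    exact hH.2.2 h1 (le_of_top hAS hK hH hKH hg h2 h3)

theorem length_filter_eq_sum {B : Type*} (p : B → Bool) (l : List B) :
    (l.filter p).length = (l.map fun a => if p a = true then 1 else 0).sum := by
  induction l with
  | nil => rfl
  | cons a l ih => by_cases h : p a = true <;> simp [h, ih, add_comm]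

theorem lev_apply_gc (σ : AddAut G) : lev (σ gc) = 6 := by
  have : ∀ x ∈ imgC, lev x = 6 := forall_of_all (by decide)
  exact this _ mem_imgC

theorem fin6_correct (hAS : A ≤ autS) (hn : NodeOK A nq 5 n K T Γ)
    (hΓ : ∀ α ∈ Γ, ∃ H ∈ regIn A nq, K ≤ H ∧ (gc, α) ∈ H) : fin6 n = cnt A nq K T [gc] := by
  obtain ⟨l, hl, hlK⟩ := hn.els_eq
  have hK := hn.isLev
  rw [cnt, ncard_eq_sum (P := fun H => H ∈ regIn A nq ∧ K ≤ H ∧ IsCanon T [gc] H) hn.nodup gc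
    fun H hH => ⟨hH.1.1, hn.all_mem H hH.1 hH.2.1⟩, fin6, hn.Γ_eq, countG_eq,
    length_filter_eq_sum]
  refine congrArg List.sum (List.map_congr_left fun α hα => ?_)
  obtain ⟨H, hH, hKH, hg⟩ := hΓ α hα
  have hgS : α ∈ autS := hAS (snd_mem_of_mem hH hg)
  have hsq := hK.sq_mem hAS hH hKH hg lev_gc
  have hconj : ∀ g ∈ K, (gc, α) * g * (gc, α)⁻¹ ∈ K := fun g h =>
    hK.conj_mem hAS hH hKH hg lev_gc h
  have hinj : ∀ x ∈ l, ∀ y ∈ l, x.1 + x.2 gc = y.1 + y.2 gc → x = y := fun x hx y hy e =>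
    hK.coset_inj hsq hconj ((hlK x).1 hx) ((hlK y).1 hy) e
  have htab := tabC_enc l hinj
  have hmin : minG (preT (tabC n.els) n.T) (ge α).m = true ↔ IsCanon T [gc] H := by
    rw [minG, allC_iff, preT_eq, hn.T_eq, List.map_map, List.forall_mem_map, IsCanon]
    refine forall₂_congr fun σ _ => ?_
    simp only [Function.comp_apply, keys, List.map_cons, List.map_nil, cons_le_cons_iff, le_refl,
      and_true]
    rw [← le_iff_lt_or_eq, Nat.ble_eq, ge_m, el_eq hH.1 hg rfl, el_cjH hH.1]
    obtain ⟨y, hy, e⟩ := hK.coset_cover hgS lev_gc hconj (lev_apply_gc (-σ))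
    rw [el_eq hH.1 (mul_mem (hKH hy) hg) e, te_pc, ← e, hl]
    have := htab.get hinj ((hlK y).2 hy)
    rw [mul_fst, this, te_s, mulP_enc, mulL_enc, te_si, mul3_enc, ← mul_assoc]
  have huniq : ∀ H', ((H' ∈ regIn A nq ∧ K ≤ H' ∧ IsCanon T [gc] H') ∧ (gc, α) ∈ H') ↔
      H' = H ∧ IsCanon T [gc] H := by
    intro H'
    constructor
    · rintro ⟨⟨h1, h2, h3⟩, h4⟩
      have : H' = H := le_antisymm (le_of_top hAS hK h1 h2 h4 hKH hg)
        (le_of_top hAS hK hH hKH hg h2 h4)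
      exact ⟨this, this ▸ h3⟩
    · rintro ⟨rfl, h⟩
      exact ⟨⟨hH, hKH, h⟩, hg⟩
  simp only [huniq]
  split_ifs with h
  · have : {H' | H' = H ∧ IsCanon T [gc] H} = {H} := by
      ext H'
      simp [hmin.1 h]
    rw [this, Set.ncard_singleton]
  · have : {H' | H' = H ∧ IsCanon T [gc] H} = ∅ := by
      ext H'
      simp [mt hmin.2 h]
    rw [this, Set.ncard_empty]

theorem lev_apply_invol (σ : AddAut G) {x : G} (hx : x + x = 0) : lev (σ x) ≤ 5 := by
  have : ∀ x ∈ invol, lev x ≤ 5 := forall_of_all (by decide)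
  exact this _ (mem_invol _ (by rw [← map_add, hx, map_zero]))

theorem step5_correct (hAS : A ≤ autS) {L : List (AddAut G)} (hL : L.Nodup)
    (hLA : ∀ α, α ∈ L ↔ α ∈ A) (hn : NodeOK A nq 4 n K T Γ) :
    step5 (L.map (ce gb)) nq fin6 n = cnt A nq K T [ga, gb, gc] := by
  have hk : lev gb = 4 + 1 := by decide
  have hdist := ncard_eq_sum (P := fun H => H ∈ regIn A nq ∧ K ≤ H ∧ IsCanon T [ga, gb, gc] H) hL
    gb fun H hH => ⟨hH.1.1, (hLA _).2 (snd_mem_of_mem hH.1 (el_mem hH.1.1 gb))⟩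
  rw [cnt, hdist, step5, sumL_eq, List.map_map]
  refine congrArg List.sum (List.map_congr_left fun α hα => ?_)
  rw [Function.comp_apply]
  rw [iteC_eq]
  split_ifs with hc
  · obtain ⟨K', hlev, hKA, hle, harr, ⟨l, hl, hcl⟩, hchild⟩ :=
      hn.exists_child hAS ((hLA α).1 hα) hk hc
    have hset : {H | (H ∈ regIn A nq ∧ K ≤ H ∧ IsCanon T [ga, gb, gc] H) ∧ (gb, α) ∈ H} =
        {H | H ∈ regIn A nq ∧ K' ≤ H ∧ IsCanon T [ga, gb, gc] H} := by
      ext H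
      simp only [Set.mem_ofPred_eq, hle]
      tauto
    have hok : ∀ β ∈ A, _ := fun β hβ => okX_iff (nq := nq) hAS hlev hKA harr hcl hβ
    have hall : ∀ H ∈ regIn A nq, K' ≤ H → (el H gc).2 ∈ Γ ∧
        okX (andC nq (allC inQC (l.map enc))) (fillC (enc (gb, α)) n.els n.arr) (l.map enc)
          (ge (el H gc).2) = true :=
      fun H hH hKH => ⟨hn.all_mem H hH ((hle H).1 hKH).1,
        (hok _ (snd_mem_of_mem hH (el_gc hH))).2 ⟨H, hH, hKH, el_gc hH⟩⟩
    rw [hset, ce_m, try5_eq, hn.T_eq, hn.Γ_eq, hl]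
    generalize hcont : (fun Γ => chkT (fillC (enc (gb, α)) n.els n.arr)
      (getC (fillC (enc (gb, α)) n.els n.arr) (nat_lit 32)) TE.pa (fun T =>
        chkT (fillC (enc (gb, α)) n.els n.arr)
          (getC (fillC (enc (gb, α)) n.els n.arr) (nat_lit 16)) TE.pb
        (fun T => fin6 (child (enc (gb, α)) n T Γ)) T []) (T.map te) []) = cont
    rcases filtG_spec ge (okX (andC nq (allC inQC (l.map enc)))
      (fillC (enc (gb, α)) n.els n.arr) (l.map enc)) cont Γ hn.nodup with
      ⟨e, hno⟩ | ⟨Γ', e, hnd, hΓ'⟩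
    · rw [e, eq_comm, Set.ncard_eq_zero]
      ext H
      simp only [Set.mem_ofPred_eq, Set.mem_empty_iff_false, iff_false]
      rintro ⟨h1, h2, -⟩
      have := hall H h1 h2
      rw [hno _ this.1] at this
      exact absurd this.2 (by simp)
    · rw [e, ← hcont]
      beta_reduce
      have hslot_a : nat_lit 32 = slot ga := by decide
      have hslot_b : nat_lit 16 = slot gb := by decide
      rcases chkT_correct (A := A) (nq := nq) hlev harr (k := ga) (by decide) hslot_a te_pa
        (fun T => chkT (fillC (enc (gb, α)) n.els n.arr)
          (getC (fillC (enc (gb, α)) n.els n.arr) (nat_lit 16)) TE.pb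
          (fun T => fin6 (child (enc (gb, α)) n T (Γ'.map ge))) T []) [gb, gc] T with
        ⟨e, hno⟩ | ⟨T₁, e, -, hT₁⟩
      · rw [e, eq_comm, Set.ncard_eq_zero]
        ext H
        simp only [Set.mem_ofPred_eq, Set.mem_empty_iff_false, iff_false]
        exact fun h => hno H h.1 h.2.1 h.2.2
      rw [e]
      have hT₁ := hT₁ fun σ => lev_apply_invol (-σ) (by decide)
      rcases chkT_correct (A := A) (nq := nq) hlev harr (k := gb) (by decide) hslot_b te_pb
        (fun T => fin6 (child (enc (gb, α)) n T (Γ'.map ge))) [gc] T₁ with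
        ⟨e, hno⟩ | ⟨T₂, e, -, hT₂⟩
      · rw [e, eq_comm, Set.ncard_eq_zero]
        ext H
        simp only [Set.mem_ofPred_eq, Set.mem_empty_iff_false, iff_false]
        rintro ⟨h1, h2, h3⟩
        exact hno H h1 h2 ((hT₁ H h1 h2).1 h3)
      rw [e]
      have hT₂ := hT₂ fun σ => lev_apply_invol (-σ) (by decide)
      have hset : {H | H ∈ regIn A nq ∧ K' ≤ H ∧ IsCanon T [ga, gb, gc] H} =
          {H | H ∈ regIn A nq ∧ K' ≤ H ∧ IsCanon T₂ [gc] H} := by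
        ext H
        simp only [Set.mem_ofPred_eq]
        exact and_congr_right fun h1 => and_congr_right fun h2 =>
          (hT₁ H h1 h2).trans (hT₂ H h1 h2)
      rw [hset]
      refine fin6_correct hAS (hchild T₂ Γ' hnd (fun β hβ => hn.mem_A β ((hΓ' β).1 hβ).1)
          fun H h1 h2 => (hΓ' _).2 (hall H h1 h2)) fun β hβ => ?_
      have := (hΓ' β).1 hβ
      exact (hok β (hn.mem_A β this.1)).1 this.2
  · rw [eq_comm, Set.ncard_eq_zero]
    ext H
    simp only [Set.mem_ofPred_eq, Set.mem_empty_iff_false, iff_false]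
    rintro ⟨⟨h1, h2, -⟩, h3⟩
    exact hc (cand_of_mem hn hAS hk h1 h2 h3)

end Correctness

/-! ### Evaluation of the enumeration -/

theorem isLev_bot : IsLev 0 (⊥ : Subgroup (Hol G)) where
  mem := bot_le
  le := by
    rintro h hh
    rw [Subgroup.mem_bot.1 hh]
    exact (lev_eq_zero.2 rfl).le
  cover x hx := ⟨1, one_mem _, (lev_eq_zero.1 (Nat.le_zero.1 hx)).symm⟩
  inj g hg h hh _ := (Subgroup.mem_bot.1 hg).trans (Subgroup.mem_bot.1 hh).symm

theorem arrOK_bot : ArrOK Prod.fst mOne ((⊥ : Subgroup (Hol G)) : Set (Hol G)) := by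
  have h : ∀ x : G, x ≠ 0 → getC mOne (slot x) = 0 := by decide +kernel
  have h0 : getC mOne (slot 0) = mOne := by decide +kernel
  intro x
  by_cases hx : x = 0
  · refine Or.inl ⟨1, one_mem _, hx.symm, ?_⟩
    rw [hx, h0, mOne_enc]
  · refine Or.inr ⟨h x hx, fun g hg e => hx ?_⟩
    rw [← e, Subgroup.mem_bot.1 hg]
    rfl

theorem root_ok {A : AddSubgroup (AddAut G)} {nq : Bool} {L : List (AddAut G)} (hL : L.Nodup)
    (hLA : ∀ α, α ∈ L ↔ α ∈ A) (T : List (AddAut G)) :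
    NodeOK A nq 0 (root (L.map ae) (T.map ae)) ⊥ T L where
  isLev := isLev_bot
  le := bot_le
  arr_ok := arrOK_bot
  els_eq := ⟨[1], by rw [root, lOne_enc]; rfl, fun h => by rw [List.mem_singleton, Subgroup.mem_bot]⟩
  gs_eq := ⟨[], rfl, by simp⟩
  T_eq := List.map_map
  Γ_eq := List.map_map
  nodup := hL
  mem_A α hα := (hLA α).1 hα
  all_mem H hH _ := (hLA _).2 (snd_mem_of_mem hH (el_mem hH.1 gc))

theorem lev_apply_multiples (σ : AddAut G) :
    lev (σ (0, 0, 8)) ≤ 1 ∧ lev (σ (0, 0, 4)) ≤ 2 ∧ lev (σ (0, 0, 2)) ≤ 3 := by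
  have h : ∀ x ∈ imgC, lev (8 • x) ≤ 1 ∧ lev (4 • x) ≤ 2 ∧ lev (2 • x) ≤ 3 :=
    forall_of_all (by decide +kernel)
  have := h _ (mem_imgC (σ := σ))
  rwa [← map_nsmul, ← map_nsmul, ← map_nsmul] at this

theorem map_mkCE {x y : ℕ} {k : G} (hx : colCode k = x) (hy : colCode (-k) = y)
    (L : List (AddAut G)) : (L.map ae).map (mkCE x y) = L.map (ce k) := by
  subst hx hy
  rw [List.map_map]
  rfl

/-- The enumeration computes the number of canonical regular subgroups. -/
theorem run_eq {A : AddSubgroup (AddAut G)} (hAS : A ≤ autS) (nq : Bool) {L : List (AddAut G)}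
    (hL : L.Nodup) (hLA : ∀ α, α ∈ L ↔ α ∈ A) (T : List (AddAut G)) :
    run nq (L.map ae) (T.map ae) (L.map ae) = {H | H ∈ regIn A nq ∧ IsCanon T allKeys H}.ncard := by
  have hfin : {H | H ∈ regIn A nq ∧ IsCanon T allKeys H}.ncard = cnt A nq ⊥ T allKeys := by
    simp only [cnt, bot_le, true_and]
  rw [hfin, run, runTop, map_mkCE (k := (0, 0, 8)) (by decide +kernel) (by decide +kernel),
    map_mkCE (k := (0, 0, 4)) (by decide +kernel) (by decide +kernel),
    map_mkCE (k := (0, 0, 2)) (by decide +kernel) (by decide +kernel),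
    map_mkCE (k := ga) (by decide +kernel) (by decide +kernel),
    map_mkCE (k := gb) (by decide +kernel) (by decide +kernel)]
  refine stepS_correct hAS hL hLA (i := 0) (by decide) (by decide +kernel) te_p8
    (Or.inr ⟨rfl, fun σ => (lev_apply_multiples _).1⟩) (fun n₁ K₁ T₁ Γ₁ hn₁ => ?_)
    (root_ok hL hLA T)
  refine stepS_correct hAS hL hLA (i := 1) (by decide) (by decide +kernel) te_p4
    (Or.inr ⟨rfl, fun σ => (lev_apply_multiples _).2.1⟩) (fun n₂ K₂ T₂ Γ₂ hn₂ => ?_) hn₁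
  refine stepS_correct hAS hL hLA (i := 2) (by decide) (by decide +kernel) te_p2
    (Or.inr ⟨rfl, fun σ => (lev_apply_multiples _).2.2⟩) (fun n₃ K₃ T₃ Γ₃ hn₃ => ?_) hn₂
  exact stepS_correct hAS hL hLA (i := 3) (by decide) (by decide +kernel) te_pa
    (Or.inl rfl) (fun n₄ K₄ T₄ Γ₄ hn₄ => step5_correct hAS hL hLA hn₄) hn₃

theorem autQ_le : autQ ≤ autS := fun _ h => h.1

theorem ncard_canonical_S {v : ℕ}
    (hv : Nat.beq (run true (autL imgS) (autL imgS) (autL imgS)) v = true) :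
    ∃ T : List (AddAut G), (∀ σ, σ ∈ T ↔ σ ∈ autS) ∧
      {H | H ∈ regIn autS true ∧ IsCanon T allKeys H}.ncard = v := by
  obtain ⟨L, hL, hnd, hmem⟩ := exists_autList imgS (fun x hx => List.mem_of_mem_take hx) (by decide)
  have hLS : ∀ σ, σ ∈ L ↔ σ ∈ autS := fun σ => (hmem σ).trans mem_imgS_iff
  refine ⟨L, hLS, ?_⟩
  rw [← Nat.eq_of_beq_eq_true hv, ← hL, run_eq le_rfl true hnd hLS L]

theorem ncard_canonical_Q {v : ℕ}
    (hv : Nat.beq (run false (autL imgQ) (autL imgA) (autL imgQ)) v = true) :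
    ∃ T : List (AddAut G), (∀ σ, σ ∈ T) ∧
      {H | H ∈ regIn autQ false ∧ IsCanon T allKeys H}.ncard = v := by
  obtain ⟨L, hL, hnd, hmem⟩ := exists_autList imgQ (fun x hx => List.mem_of_mem_take hx) (by decide)
  obtain ⟨T, hT, -, hmemT⟩ := exists_autList imgA (fun x hx => hx) (by decide)
  have hLQ : ∀ σ, σ ∈ L ↔ σ ∈ autQ := fun σ => (hmem σ).trans mem_imgQ_iff
  refine ⟨T, fun σ => (hmemT σ).2 mem_imgA, ?_⟩
  rw [← Nat.eq_of_beq_eq_true hv, ← hL, ← hT, run_eq autQ_le false hnd hLQ T]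

/-! ### Conjugacy classes of regular subgroups -/

/-- The image in the quotient of the elements of order at most `2` by `(0, 0, 8)`. -/
def pr (x : G) : ZMod 2 × ZMod 2 := (x.1, x.2.1)

theorem eq_or_of_pr_eq_zero : ∀ x : G, x + x = 0 → pr x = 0 → x = 0 ∨ x = (0, 0, 8) := by
  decide +kernel

theorem pr_apply_congr (σ : AddAut G) {x y : G} (hx : x + x = 0) (hy : y + y = 0)
    (h : pr x = pr y) : pr (σ x) = pr (σ y) := by
  have hd : σ x = σ y + σ (x - y) := by rw [← map_add, add_sub_cancel]
  have hxy : x - y + (x - y) = 0 := by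
    rw [sub_add_sub_comm, hx, hy, sub_zero]
  have hpr : pr (x - y) = 0 := by
    have : pr (x - y) = pr x - pr y := rfl
    rw [this, h, sub_self]
  rcases eq_or_of_pr_eq_zero _ hxy hpr with e | e
  · rw [hd, e, map_zero, add_zero]
  · rw [hd, e, map_eight]
    exact add_zero (pr (σ y))

theorem apply_add_self (σ : AddAut G) {x : G} (hx : x + x = 0) : σ x + σ x = 0 := by
  rw [← map_add, hx, map_zero]

theorem mem_autS_iff_pr {σ : AddAut G} : σ ∈ autS ↔ pr (σ ga) = (1, 0) := by
  rw [mem_autS_iff, pr, Prod.mk.injEq]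

theorem exists_eq_mk : ∀ x : G, x + x = 0 → ∃ r : ZMod 16, x = (x.1, x.2.1, 2 * r) := by
  decide +kernel

theorem pr_apply_of_mem_autS {σ : AddAut G} (hσ : σ ∈ autS) {x : G} (hx : x + x = 0) :
    pr (σ x) = (x.1 + x.2.1 * (σ gb).1, x.2.1) := by
  obtain ⟨r, hr⟩ := exists_eq_mk x hx
  have := autS_first hσ x.1 x.2.1 r
  rw [← hr] at this
  exact Prod.ext this.1 this.2

theorem mem_autQ_iff_pr {σ : AddAut G} : σ ∈ autQ ↔ ∀ x, x + x = 0 → pr (σ x) = pr x := by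
  constructor
  · intro h x hx
    rw [pr_apply_of_mem_autS h.1 hx, h.2, mul_zero, add_zero]
    rfl
  · intro h
    exact ⟨mem_autS_iff_pr.2 (h ga (by decide)), congrArg Prod.fst (h gb (by decide))⟩

theorem autQ_normal {α : AddAut G} (hα : α ∈ autQ) (σ : AddAut G) : σ + α + -σ ∈ autQ := by
  rw [mem_autQ_iff_pr] at hα ⊢
  intro x hx
  have hy := apply_add_self (-σ) hx
  have : (σ + α + -σ) x = σ (α ((-σ) x)) := rfl
  rw [this, pr_apply_congr σ (apply_add_self α hy) hy (hα _ hy), apply_neg_apply]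

theorem cjH_le_autQ {H : Subgroup (Hol G)} (hH : H ≤ holOf autQ) (σ : AddAut G) :
    cjH σ H ≤ holOf autQ := by
  rintro _ ⟨h, hh, rfl⟩
  exact autQ_normal (hH hh) σ

theorem cjH_le {A : AddSubgroup (AddAut G)} {H : Subgroup (Hol G)} (hH : H ≤ holOf A)
    {σ : AddAut G} (hσ : σ ∈ A) : cjH σ H ≤ holOf A := by
  rintro _ ⟨h, hh, rfl⟩
  exact add_mem (add_mem hσ (hH hh)) (neg_mem hσ)

/-- Automorphisms conjugating a subgroup with a nontrivial action on the quotient preserve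
the filtration. -/
theorem mem_autS_of_cjH_le {H : Subgroup (Hol G)} (hS : H ≤ holOf autS) (hQ : ¬ H ≤ holOf autQ)
    {σ : AddAut G} (hσ : cjH σ H ≤ holOf autS) : σ ∈ autS := by
  obtain ⟨h, hh, hhQ⟩ := SetLike.not_le_iff_exists.1 hQ
  have hα : h.2 ∈ autS := hS hh
  have hβ : σ + h.2 + -σ ∈ autS := hσ ⟨h, hh, rfl⟩
  have hga : ga + ga = 0 := by decide
  have hgb : (h.2 gb).1 = 1 := by
    have h1 : (h.2 gb).1 ≠ 0 := fun e => hhQ ⟨hα, e⟩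
    generalize (h.2 gb).1 = z at h1
    revert z
    decide
  rw [← neg_mem_iff, mem_autS_iff_pr]
  have hy := apply_add_self (-σ) hga
  have hfix : pr (h.2 ((-σ) ga)) = pr ((-σ) ga) := by
    have h1 : pr ((σ + h.2 + -σ) ga) = pr ga := mem_autS_iff_pr.1 hβ
    have h2 := pr_apply_congr (-σ) (apply_add_self _ hga) hga h1
    have h3 : (-σ) ((σ + h.2 + -σ) ga) = h.2 ((-σ) ga) := neg_apply_apply σ _
    rwa [h3] at h2
  have hne : pr ((-σ) ga) ≠ 0 := by
    intro e
    have h1 := pr_apply_congr σ hy (add_zero 0) (e.trans (rfl : (0 : ZMod 2 × ZMod 2) = pr 0))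
    rw [apply_neg_apply, map_zero] at h1
    exact absurd h1 (by decide)
  rw [pr_apply_of_mem_autS hα hy, hgb, mul_one] at hfix
  generalize (-σ) ga = y at hfix hne
  have key : ∀ p q : ZMod 2, (p + q, q) = (p, q) → (p, q) ≠ 0 → (p, q) = (1, 0) := by decide
  exact key _ _ hfix hne

/-- The nonzero elements of the quotient. -/
abbrev Pt : Type := {y : ZMod 2 × ZMod 2 // y ≠ 0}

theorem mk_add_self : ∀ y : ZMod 2 × ZMod 2, ((y.1, y.2, 0) + (y.1, y.2, 0) : G) = 0 := by
  decide

/-- The action of the holomorph on the nonzero elements of the quotient. -/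
instance : MulAction (Hol G) Pt where
  smul h y := ⟨pr (h.2 (y.1.1, y.1.2, 0)), fun e => y.2 (by
    have h1 := pr_apply_congr (-h.2) (apply_add_self h.2 (mk_add_self y.1)) (add_zero 0)
      (e.trans (rfl : (0 : ZMod 2 × ZMod 2) = pr 0))
    rwa [neg_apply_apply, map_zero] at h1)⟩
  one_smul y := rfl
  mul_smul g h y := Subtype.ext (pr_apply_congr g.2 (apply_add_self h.2 (mk_add_self y.1))
    (mk_add_self _) rfl)

theorem card_of_isRegular {H : Subgroup (Hol G)} (hH : Hol.IsRegular H) : Nat.card H = 2 ^ 6 := by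
  obtain ⟨h1, h2⟩ := isRegular_iff.1 hH
  have hb : Function.Bijective fun h : H => h.1.1 :=
    ⟨fun g h e => Subtype.ext (h2 g g.2 h h.2 e), fun x => by
      obtain ⟨h, hh, e⟩ := h1 x
      exact ⟨⟨h, hh⟩, e⟩⟩
  rw [Nat.card_congr (Equiv.ofBijective _ hb), Nat.card_eq_fintype_card]
  rfl

theorem exists_cjH_le_autS {H : Subgroup (Hol G)} (hH : Hol.IsRegular H) :
    ∃ σ, cjH σ H ≤ holOf autS := by
  have hp : IsPGroup 2 H := IsPGroup.of_card (card_of_isRegular hH)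
  obtain ⟨y, hy⟩ := hp.nonempty_fixed_point_of_prime_not_dvd_card Pt (by
    rw [Nat.card_eq_fintype_card]
    decide)
  have hex : ∀ y : ZMod 2 × ZMod 2, y ≠ 0 → ∃ x ∈ imgA, x.1 = (y.1, y.2, 0) := by decide +kernel
  obtain ⟨x, hx, hxy⟩ := hex y.1 y.2
  obtain ⟨τ, hτ, -, -⟩ := exists_aut hx (show gc ∈ imgC by decide)
  refine ⟨-τ, ?_⟩
  rintro _ ⟨h, hh, rfl⟩
  refine mem_autS_iff_pr.2 ?_
  have h1 : pr (h.2 (τ ga)) = pr (τ ga) := by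
    rw [hτ, hxy]
    exact congrArg Subtype.val (hy ⟨h, hh⟩)
  have hga := apply_add_self τ (show ga + ga = 0 by decide)
  have h2 := pr_apply_congr (-τ) (apply_add_self h.2 hga) hga h1
  rw [neg_apply_apply] at h2
  have h3 : (-τ + h.2 + - -τ) ga = (-τ) (h.2 (τ ga)) := rfl
  exact (congrArg pr h3).trans h2

/-- Every class has a canonical element. -/
theorem exists_isCanon {A : AddSubgroup (AddAut G)} {T : List (AddAut G)}
    (hT : ∀ σ, σ ∈ T ↔ σ ∈ A) (H : Subgroup (Hol G)) :
    ∃ τ ∈ A, IsCanon T allKeys (cjH τ H) := by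
  obtain ⟨τ, hτ⟩ := Finite.exists_min fun τ : A => keys allKeys (cjH τ H)
  refine ⟨τ, τ.2, fun σ hσ => ?_⟩
  rw [cjH_cjH]
  exact hτ ⟨σ + τ, add_mem ((hT σ).1 hσ) τ.2⟩

/-- A class has at most one canonical element. -/
theorem isCanon_unique {A : AddSubgroup (AddAut G)} {T : List (AddAut G)}
    (hT : ∀ σ, σ ∈ T ↔ σ ∈ A) {H : Subgroup (Hol G)} (hH : Hol.IsRegular H)
    (hS : H ≤ holOf autS) (hc : IsCanon T allKeys H) {σ : AddAut G} (hσ : σ ∈ A)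
    (hS' : cjH σ H ≤ holOf autS) (hc' : IsCanon T allKeys (cjH σ H)) : H = cjH σ H := by
  refine keys_injective hH hS (IsRegular.cjH hH σ) hS' (le_antisymm (hc σ ((hT σ).2 hσ)) ?_)
  have := hc' (-σ) ((hT _).2 (neg_mem hσ))
  rwa [cjH_neg_cjH] at this

theorem equivalence_conjugate : Equivalence
    fun H₁ H₂ : {H : Subgroup (Hol G) // Hol.IsRegular H} => ConjugateSubgroups H₁.1 H₂.1 := by
  refine ⟨fun H => (conjugate_iff H.2).2 ⟨0, cjH_zero _⟩, fun {H H'} h => ?_,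
    fun {H H' H''} h h' => ?_⟩
  · obtain ⟨σ, e⟩ := (conjugate_iff H.2).1 h
    exact (conjugate_iff H'.2).2 ⟨-σ, by rw [← e, cjH_neg_cjH]⟩
  · obtain ⟨σ, e⟩ := (conjugate_iff H.2).1 h
    obtain ⟨τ, e'⟩ := (conjugate_iff H'.2).1 h'
    exact (conjugate_iff H.2).2 ⟨τ + σ, by rw [← e', ← e, cjH_cjH]⟩

/-- The conjugacy classes of regular subgroups are counted by the canonical subgroups. -/
theorem card_classes {TS TA : List (AddAut G)} (hTS : ∀ σ, σ ∈ TS ↔ σ ∈ autS)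
    (hTA : ∀ σ, σ ∈ TA) :
    Nat.card (Quot (fun H₁ H₂ : {H : Subgroup (Hol G) // Hol.IsRegular H} =>
      ConjugateSubgroups H₁.1 H₂.1)) =
    {H | H ∈ regIn autQ false ∧ IsCanon TA allKeys H}.ncard +
      {H | H ∈ regIn autS true ∧ IsCanon TS allKeys H}.ncard := by
  have hTA : ∀ σ, σ ∈ TA ↔ σ ∈ (⊤ : AddSubgroup (AddAut G)) := fun σ => by simp [hTA σ]
  have hdisj : Disjoint {H | H ∈ regIn autQ false ∧ IsCanon TA allKeys H}
      {H | H ∈ regIn autS true ∧ IsCanon TS allKeys H} :=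
    Set.disjoint_left.2 fun H h1 h2 => h2.1.2.2 rfl h1.1.2.1
  rw [← Set.ncard_union_eq hdisj (Set.toFinite _) (Set.toFinite _), ← Nat.card_coe_set_eq]
  have hreg : ∀ H ∈ {H | H ∈ regIn autQ false ∧ IsCanon TA allKeys H} ∪
      {H | H ∈ regIn autS true ∧ IsCanon TS allKeys H}, Hol.IsRegular H := by
    rintro H (h | h)
    exacts [h.1.1, h.1.1]
  refine (Nat.card_congr (Equiv.ofBijective
    (fun H => Quot.mk _ ⟨H.1, hreg H.1 H.2⟩) ⟨?_, ?_⟩)).symm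
  · rintro ⟨H, hH⟩ ⟨H', hH'⟩ e
    have hr := hreg H hH
    obtain ⟨σ, rfl⟩ := (conjugate_iff hr).1 (equivalence_conjugate.quot_mk_eq_iff _ _ |>.1 e)
    refine Subtype.ext ?_
    rcases hH with h | h <;> rcases hH' with h' | h'
    · exact isCanon_unique hTA hr (fun x hx => (h.1.2.1 hx).1) h.2 trivial
        (fun x hx => (h'.1.2.1 hx).1) h'.2
    · exact absurd (cjH_le_autQ h.1.2.1 σ) (h'.1.2.2 rfl)
    · refine absurd ?_ (h.1.2.2 rfl)
      have := cjH_le_autQ h'.1.2.1 (-σ)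
      rwa [cjH_neg_cjH] at this
    · exact isCanon_unique hTS hr h.1.2.1 h.2 (mem_autS_of_cjH_le h.1.2.1 (h.1.2.2 rfl) h'.1.2.1)
        h'.1.2.1 h'.2
  · rintro ⟨H, hH⟩
    obtain ⟨σ, hσ⟩ := exists_cjH_le_autS hH
    have hr := IsRegular.cjH hH σ
    suffices ∃ τ, cjH τ (cjH σ H) ∈ {H | H ∈ regIn autQ false ∧ IsCanon TA allKeys H} ∪
        {H | H ∈ regIn autS true ∧ IsCanon TS allKeys H} by
      obtain ⟨τ, hτ⟩ := this
      refine ⟨⟨_, hτ⟩, Quot.sound ((conjugate_iff (IsRegular.cjH hr τ)).2 ⟨-(τ + σ), ?_⟩)⟩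
      rw [cjH_cjH τ σ, cjH_neg_cjH]
    by_cases hQ : cjH σ H ≤ holOf autQ
    · obtain ⟨τ, -, hc⟩ := exists_isCanon hTA (cjH σ H)
      exact ⟨τ, Or.inl ⟨⟨IsRegular.cjH hr τ, cjH_le_autQ hQ τ, by simp⟩, hc⟩⟩
    · obtain ⟨τ, hτ, hc⟩ := exists_isCanon hTS (cjH σ H)
      refine ⟨τ, Or.inr ⟨⟨IsRegular.cjH hr τ, cjH_le hσ hτ, fun _ h => hQ ?_⟩, hc⟩⟩
      have := cjH_le_autQ h (-τ)
      rwa [cjH_neg_cjH] at this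

/-! ### Left braces and regular subgroups -/

theorem equivalence_iso {B : Type*} {p : LeftBrace B → Prop} :
    Equivalence fun L₁ L₂ : {L : LeftBrace B // p L} => L₁.1.Iso L₂.1 where
  refl L := ⟨Equiv.refl _, fun _ _ => rfl, fun _ _ => rfl⟩
  symm := by
    rintro L L' ⟨f, hadd, hmul⟩
    exact ⟨f.symm, fun x y => f.injective (by simp [hadd]), fun x y => f.injective (by simp [hmul])⟩
  trans := by
    rintro L L' L'' ⟨f, hadd, hmul⟩ ⟨f', hadd', hmul'⟩
    exact ⟨f.trans f', fun x y => by simp [hadd, hadd'], fun x y => by simp [hmul, hmul']⟩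

section Braces

variable {B : Type*} {H H' : Subgroup (Hol G)}

theorem el_mul (hH : Hol.IsRegular H) (x y : G) :
    el H (x + (el H x).2 y) = el H x * el H y :=
  el_eq hH (mul_mem (el_mem hH x) (el_mem hH y)) (by rw [mul_fst, el_fst hH, el_fst hH])

theorem el_zero (hH : Hol.IsRegular H) : el H 0 = 1 := el_eq hH (one_mem H) rfl

/-- The left brace of a regular subgroup. -/
noncomputable def braceOf (e : B ≃ G) (hH : Hol.IsRegular H) : LeftBrace B where
  add a b := e.symm (e a + e b)
  zero := e.symm 0
  neg a := e.symm (-e a)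
  mul a b := e.symm (e a + (el H (e a)).2 (e b))
  one := e.symm 0
  inv a := e.symm (el H (e a))⁻¹.1
  add_assoc a b c := by simp [add_assoc]
  add_comm a b := by simp [add_comm]
  zero_add a := by simp
  neg_add_cancel a := by simp
  mul_assoc a b c := by
    simp only [Equiv.apply_symm_apply, el_mul hH, mul_snd, add_assoc, EmbeddingLike.apply_eq_iff_eq,
      map_add]
    rfl
  one_mul a := by
    simp only [Equiv.apply_symm_apply, el_zero hH, zero_add]
    exact e.symm_apply_apply a
  mul_one a := by simp
  inv_mul_cancel a := by
    have h : el H (el H (e a))⁻¹.1 = (el H (e a))⁻¹ := el_eq hH (inv_mem (el_mem hH _)) rfl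
    have h' := congrArg Prod.fst (inv_mul_cancel (el H (e a)))
    rw [mul_fst, el_fst hH] at h'
    simp only [Equiv.apply_symm_apply, h, h']
    rfl
  brace x y z := by
    simp only [Equiv.apply_symm_apply, map_add, EmbeddingLike.apply_eq_iff_eq]
    abel

theorem braceOf_addIso (e : B ≃ G) (hH : Hol.IsRegular H) : (braceOf e hH).AddIso G :=
  ⟨e, fun _ _ => e.apply_symm_apply _⟩

theorem braceOf_add (e : B ≃ G) (hH : Hol.IsRegular H) (a b : B) :
    (braceOf e hH).add a b = e.symm (e a + e b) := rfl

theorem braceOf_mul (e : B ≃ G) (hH : Hol.IsRegular H) (a b : B) :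
    (braceOf e hH).mul a b = e.symm (e a + (el H (e a)).2 (e b)) := rfl

theorem eq_of_le_of_isRegular (hH : Hol.IsRegular H) (hH' : Hol.IsRegular H') (hle : H ≤ H') :
    H = H' := by
  refine le_antisymm hle fun h hh => ?_
  rw [← el_eq hH' hh rfl, el_eq hH' (hle (el_mem hH h.1)) (el_fst hH _)]
  exact el_mem hH _

theorem braceOf_iso_iff (e : B ≃ G) (hH : Hol.IsRegular H) (hH' : Hol.IsRegular H') :
    (braceOf e hH).Iso (braceOf e hH') ↔ ConjugateSubgroups H H' := by
  rw [conjugate_iff hH]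
  constructor
  · rintro ⟨f, hadd, hmul⟩
    let σ : AddAut G :=
      { (e.symm.trans f).trans e with
        map_add' := fun x y => by
          have := congrArg e (hadd (e.symm x) (e.symm y))
          simpa [braceOf_add] using this }
    have hσ : ∀ x y, σ (x + (el H x).2 y) = σ x + (el H' (σ x)).2 (σ y) := fun x y => by
      have := congrArg e (hmul (e.symm x) (e.symm y))
      simp only [braceOf_mul, Equiv.apply_symm_apply] at this
      exact this
    refine ⟨σ, eq_of_le_of_isRegular (IsRegular.cjH hH σ) hH' ?_⟩
    rintro _ ⟨h, hh, rfl⟩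
    have hel : el H' (σ h.1) = (0, σ) * h * (0, σ)⁻¹ := by
      refine Prod.ext ?_ ?_
      · rw [el_fst hH', conj_aut_fst]
      · rw [conj_aut_snd]
        refine AddEquiv.ext fun y => ?_
        have h1 := hσ h.1 ((-σ) y)
        rw [map_add, apply_neg_apply, add_right_inj, el_eq hH hh rfl] at h1
        exact h1.symm
    have := el_mem hH' (σ h.1)
    rw [hel] at this
    exact this
  · rintro ⟨σ, rfl⟩
    refine ⟨(e.trans σ.toEquiv).trans e.symm, fun a b => ?_, fun a b => ?_⟩
    · simp [braceOf_add]
    · simp only [braceOf_mul, el_cjH hH, conj_aut_snd, Equiv.trans_apply, Equiv.apply_symm_apply,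
        EmbeddingLike.apply_eq_iff_eq, AddEquiv.toEquiv_eq_coe, AddEquiv.coe_toEquiv, map_add,
        add_right_inj, neg_apply_apply]
      have : (σ + (el H (e a)).2 + -σ) (σ (e b)) = σ ((el H (e a)).2 ((-σ) (σ (e b)))) := rfl
      rw [this, neg_apply_apply]

/-- The regular subgroup of a left brace structure with additive group `G`. -/
theorem exists_isRegular_of_mul (m : G → G → G) (n : G → G)
    (hassoc : ∀ x y z, m (m x y) z = m x (m y z)) (hone : ∀ y, m 0 y = y)
    (hinv : ∀ x, m (n x) x = 0) (hbrace : ∀ x y z, m x (y + z) = m x y - x + m x z) :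
    ∃ H : Subgroup (Hol G), Hol.IsRegular H ∧ ∀ x y, x + (el H x).2 y = m x y := by
  have hzero : ∀ x, m x 0 = x := fun x => by
    have := hbrace x 0 0
    rw [add_zero] at this
    have h2 := congrArg (fun y => y - m x 0 + x) this
    simpa using h2.symm
  have hcancel : ∀ x y z, m x y = m x z → y = z := fun x y z e => by
    have := congrArg (m (n x)) e
    rwa [← hassoc, ← hassoc, hinv, hone, hone] at this
  have hlam : ∀ x, ∃ α : AddAut G, ∀ y, x + α y = m x y := fun x => by
    let φ : G →+ G := AddMonoidHom.mk' (fun y => m x y - x) fun y z => by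
      rw [hbrace]
      abel
    have hφ : Function.Injective φ := fun y z e => hcancel x y z (sub_left_injective e)
    exact ⟨AddEquiv.ofBijective φ (Finite.injective_iff_bijective.1 hφ),
      fun y => add_sub_cancel x (m x y)⟩
  let H : Subgroup (Hol G) :=
    { carrier := {h | ∀ y, h.1 + h.2 y = m h.1 y}
      one_mem' := fun y => (zero_add y).trans (hone y).symm
      mul_mem' := fun {g h} hg hh y => by
        have h1 : (g * h).1 + (g * h).2 y = g.1 + g.2 (h.1 + h.2 y) := by
          rw [mul_fst, map_add, add_assoc]
          rfl
        rw [h1, hh, hg, mul_fst, hg, hassoc]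
      inv_mem' := fun {h} hh y => by
        refine hcancel h.1 _ _ ?_
        have h1 : m h.1 (h⁻¹.1 + h⁻¹.2 y) = y := by
          rw [← hh, inv_fst, inv_snd, map_add, map_neg, apply_neg_apply, apply_neg_apply]
          abel
        have h2 : m h.1 h⁻¹.1 = 0 := by
          rw [← hh, inv_fst, map_neg, apply_neg_apply, add_neg_cancel]
        rw [h1, ← hassoc, h2, hone] }
  have hmem : ∀ h : Hol G, h ∈ H ↔ ∀ y, h.1 + h.2 y = m h.1 y := fun h => Iff.rfl
  have hH : Hol.IsRegular H := by
    refine isRegular_iff.2 ⟨fun x => ?_, fun g hg h hh e => Prod.ext e (AddEquiv.ext fun y => ?_)⟩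
    · obtain ⟨α, hα⟩ := hlam x
      exact ⟨(x, α), hα, rfl⟩
    · have h1 := (hmem g).1 hg y
      rw [e, ← (hmem h).1 hh y] at h1
      exact add_left_cancel h1
  refine ⟨H, hH, fun x y => ?_⟩
  have := (hmem _).1 (el_mem hH x) y
  rwa [el_fst hH] at this

theorem exists_braceOf_iso (e : B ≃ G) (L : LeftBrace B) (hL : L.AddIso G) :
    ∃ (H : Subgroup (Hol G)) (hH : Hol.IsRegular H), (braceOf e hH).Iso L := by
  obtain ⟨f, hf⟩ := hL
  have hadd : ∀ x y, f.symm (x + y) = L.add (f.symm x) (f.symm y) := fun x y =>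
    f.injective (by simp [hf])
  have hz : f L.zero = 0 := by
    have := hf L.zero L.zero
    rw [L.zero_add] at this
    simpa using this.symm
  have hneg : ∀ a, f (L.neg a) = -f a := fun a => by
    have := hf (L.neg a) a
    rw [L.neg_add_cancel, hz] at this
    exact eq_neg_of_add_eq_zero_left this.symm
  have hbrace : ∀ x y z, f (L.mul (f.symm x) (f.symm (y + z))) =
      f (L.mul (f.symm x) (f.symm y)) - x + f (L.mul (f.symm x) (f.symm z)) := fun x y z => by
    rw [hadd, L.brace, hf, hf, hneg, Equiv.apply_symm_apply, sub_eq_add_neg]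
  have hone : f L.one = 0 := by
    have := hbrace (f L.one) 0 0
    simp only [add_zero, Equiv.symm_apply_apply, L.one_mul, Equiv.apply_symm_apply, zero_sub] at this
    exact neg_eq_zero.1 this.symm
  have hone' : f.symm 0 = L.one := by rw [← hone, Equiv.symm_apply_apply]
  obtain ⟨H, hH, hm⟩ := exists_isRegular_of_mul (fun x y => f (L.mul (f.symm x) (f.symm y)))
    (fun x => f (L.inv (f.symm x))) (fun x y z => by simp [L.mul_assoc])
    (fun y => by simp [hone', L.one_mul]) (fun x => by simp [L.inv_mul_cancel, hone]) hbrace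
  refine ⟨H, hH, e.trans f.symm, fun a b => ?_, fun a b => ?_⟩
  · simp [braceOf_add, hadd]
  · simp [braceOf_mul, hm]

/-- Left braces are classified by conjugacy classes of regular subgroups. -/
theorem card_braces (e : B ≃ G) :
    Nat.card (Quot fun L₁ L₂ : {L : LeftBrace B // L.AddIso G} => L₁.1.Iso L₂.1) =
    Nat.card (Quot fun H₁ H₂ : {H : Subgroup (Hol G) // Hol.IsRegular H} =>
      ConjugateSubgroups H₁.1 H₂.1) := by
  let F : {H : Subgroup (Hol G) // Hol.IsRegular H} → {L : LeftBrace B // L.AddIso G} :=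
    fun H => ⟨braceOf e H.2, braceOf_addIso e H.2⟩
  have hF : ∀ H H' : {H : Subgroup (Hol G) // Hol.IsRegular H},
      (F H).1.Iso (F H').1 ↔ ConjugateSubgroups H.1 H'.1 :=
    fun H H' => braceOf_iso_iff e H.2 H'.2
  refine (Nat.card_congr (Equiv.ofBijective
    (Quot.map F fun H H' h => (hF H H').2 h) ⟨?_, ?_⟩)).symm
  · rintro ⟨H⟩ ⟨H'⟩ h
    exact Quot.sound ((hF H H').1 ((equivalence_iso.quot_mk_eq_iff _ _).1 h))
  · rintro ⟨L, hL⟩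
    obtain ⟨H, hH, h⟩ := exists_braceOf_iso e L hL
    exact ⟨Quot.mk _ ⟨H, hH⟩, Quot.sound h⟩

end Braces

/-! ### The count -/

set_option maxRecDepth 100000 in
theorem run_S : Nat.beq (run true (autL imgS) (autL imgS) (autL imgS)) 1920 = true := by
  decide +kernel

set_option maxRecDepth 100000 in
theorem run_Q : Nat.beq (run false (autL imgQ) (autL imgA) (autL imgQ)) 1204 = true := by
  decide +kernel

theorem card_classes_eq :
    Nat.card (Quot (fun H₁ H₂ : {H : Subgroup (Hol G) // Hol.IsRegular H} =>
      ConjugateSubgroups H₁.1 H₂.1)) = 3124 := by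
  obtain ⟨TS, hTS, hS⟩ := ncard_canonical_S run_S
  obtain ⟨TA, hTA, hQ⟩ := ncard_canonical_Q run_Q
  rw [card_classes hTS hTA, hQ, hS]

end HolCount

/-- The number of conjugacy classes of regular subgroups of the holomorph of
`G = C₂ × C₂ × C₁₆` is `3124`; equivalently, the number of isomorphism classes of left
braces with additive group isomorphic to `G` is `3124`. -/
theorem regular_subgroups_and_braces_count :
    Nat.card (Quot (fun (H₁ H₂ : {H : Subgroup (Hol (ZMod 2 × ZMod 2 × ZMod 16)) //
        Hol.IsRegular H}) => ConjugateSubgroups H₁.1 H₂.1)) = 3124 ∧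
    Nat.card (Quot (fun (L₁ L₂ : {L : LeftBrace (Fin 64) //
        L.AddIso (ZMod 2 × ZMod 2 × ZMod 16)}) => L₁.1.Iso L₂.1)) = 3124 := by
  have e : Fin 64 ≃ HolCount.G := (Fintype.equivFinOfCardEq (by simp [ZMod.card])).symm
  exact ⟨HolCount.card_classes_eq, (HolCount.card_braces e).trans HolCount.card_classes_eq⟩
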